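/- arXiv:0704.1943 — 8 statements merged into one kernel-verified Lean document; each statement's English description precedes it below -/
import Mathlib

section
/- Let d ≥ 1 and j ≥ 1 be integers. If the monomial y^j·w^j does not belong to the ideal of 𝔽₂[y,w] generated by π_{d+1} and π_{d+2}, then there is no continuous D₈-equivariant map from S^d × S^d to the unit sphere S(R₄^{⊕j}). -/
open MvPolynomial

noncomputable section

/-- There exists a continuous `D₈`-equivariant map `S^d × S^d → S(R₄^{⊕j})`.

Here `S^d` is the unit sphere of `ℝ^{d+1}`; `ℝ⁴` is modelled as `(Bool × Bool) → ℝ`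
(a coordinate index `(b₁, b₂) : Bool × Bool` encodes a sign pair `(α₁, α₂) ∈ {+1,−1}²`,
with `!` encoding sign flip), `R₄^{⊕j}` as the subspace of `Fin j × Bool × Bool → ℝ` of
vectors each of whose `j` blocks has coordinate sum `0`, and `S(R₄^{⊕j})` as its unit
sphere `{x | Σ_p x_p² = 1}`.  Equivariance with respect to `D₈ = (ℤ/2 × ℤ/2) ⋊ ℤ/2` is
expressed by equivariance for its generators `ε₁, ε₂, σ`, which act on the domain by
`ε₁·(u,v) = (−u,v)`, `ε₂·(u,v) = (u,−v)`, `σ·(u,v) = (v,u)` and on the target by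
`(ε₁·x)_{(i,(α₁,α₂))} = x_{(i,(−α₁,α₂))}`, `(ε₂·x)_{(i,(α₁,α₂))} = x_{(i,(α₁,−α₂))}`,
`(σ·x)_{(i,(α₁,α₂))} = x_{(i,(α₂,α₁))}`. -/
def ExistsD8EquivariantMap (d j : ℕ) : Prop :=
  ∃ f : C(Metric.sphere (0 : EuclideanSpace ℝ (Fin (d + 1))) 1 ×
           Metric.sphere (0 : EuclideanSpace ℝ (Fin (d + 1))) 1,
         Fin j × Bool × Bool → ℝ),
    (∀ x, ∑ p : Fin j × Bool × Bool, (f x p) ^ 2 = 1) ∧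
    (∀ x (i : Fin j), ∑ b : Bool × Bool, f x (i, b) = 0) ∧
    (∀ u v, f (-u, v) = fun p => f (u, v) (p.1, (!p.2.1, p.2.2))) ∧
    (∀ u v, f (u, -v) = fun p => f (u, v) (p.1, (p.2.1, !p.2.2))) ∧
    (∀ u v, f (v, u) = fun p => f (u, v) (p.1, (p.2.2, p.2.1)))

/-- The polynomial `π_d ∈ 𝔽₂[y,w]` (with `y = X 0`, `w = X 1`):
`π_d = Σ_{0 ≤ 2i ≤ d−1} C(d−1−i, i)·w^i·y^{d−2i}`, coefficients mod 2. -/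
def piF2 (d : ℕ) : MvPolynomial (Fin 2) (ZMod 2) :=
  ∑ i ∈ Finset.range (d + 1),
    if 2 * i + 1 ≤ d then
      C (((d - 1 - i).choose i : ZMod 2)) * X 1 ^ i * X 0 ^ (d - 2 * i)
    else 0

/-- Mod 2 chains of finite lists of points of `X`; a list of length `n + 1` is an `n`-simplex. -/
abbrev ListChain (X : Type*) := List X →₀ ZMod 2

namespace ListChain

variable {X Y ι : Type*}

/-- The linear extension of `List.cons x`: the cone with apex `x`. -/
def cone (x : X) : ListChain X →ₗ[ZMod 2] ListChain X :=
  Finsupp.lmapDomain (ZMod 2) (ZMod 2) (List.cons x)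

/-- The map induced on chains by a map of points. -/
def push (g : X → Y) : ListChain X →ₗ[ZMod 2] ListChain Y :=
  Finsupp.lmapDomain (ZMod 2) (ZMod 2) (List.map g)

/-- The augmented boundary of a list, the sum of the lists obtained by omitting one entry. -/
def boundaryList : List X → ListChain X
  | [] => 0
  | x :: l => Finsupp.single l 1 + cone x (boundaryList l)

/-- The augmented boundary operator. -/
def boundary : ListChain X →ₗ[ZMod 2] ListChain X :=
  Finsupp.linearCombination (ZMod 2) boundaryList

@[simp] lemma cone_single (x : X) (l : List X) (r : ZMod 2) :
    cone x (Finsupp.single l r) = Finsupp.single (x :: l) r := by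
  simp [cone]

@[simp] lemma push_single (g : X → Y) (l : List X) (r : ZMod 2) :
    push g (Finsupp.single l r) = Finsupp.single (l.map g) r := by
  simp [push]

@[simp] lemma boundary_single (l : List X) :
    boundary (Finsupp.single l 1) = boundaryList l := by
  simp [boundary]

lemma add_self_eq_zero (A : ListChain X) : A + A = 0 := ZModModule.add_self A

/-- Linear maps out of chains agree when they agree on lists. -/
lemma linearMap_ext {M : Type*} [AddCommGroup M] [Module (ZMod 2) M]
    {F G : ListChain X →ₗ[ZMod 2] M}
    (h : ∀ l, F (Finsupp.single l 1) = G (Finsupp.single l 1)) : F = G := by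
  refine Finsupp.lhom_ext' fun l => LinearMap.ext_ring ?_
  simpa using h l

lemma boundary_cone (x : X) (A : ListChain X) :
    boundary (cone x A) = A + cone x (boundary A) := by
  have : boundary ∘ₗ cone x = LinearMap.id + cone x ∘ₗ boundary :=
    linearMap_ext fun l => by simp [boundaryList]
  exact LinearMap.congr_fun this A

lemma boundary_boundaryList (l : List X) : boundary (boundaryList l) = 0 := by
  induction l with
  | nil => simp [boundaryList]
  | cons x l ih =>
    simp [boundaryList, boundary_cone, ih, add_self_eq_zero]

lemma boundary_boundary (A : ListChain X) : boundary (boundary A) = 0 := by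
  have : boundary ∘ₗ boundary = (0 : ListChain X →ₗ[ZMod 2] ListChain X) :=
    linearMap_ext fun l => by simp [boundary_boundaryList]
  exact LinearMap.congr_fun this A

lemma push_cone (g : X → Y) (x : X) (A : ListChain X) :
    push g (cone x A) = cone (g x) (push g A) := by
  have : push g ∘ₗ cone x = cone (g x) ∘ₗ push g := linearMap_ext fun l => by simp
  exact LinearMap.congr_fun this A

lemma push_boundary (g : X → Y) (A : ListChain X) :
    push g (boundary A) = boundary (push g A) := by
  have : push g ∘ₗ boundary = boundary ∘ₗ push g := linearMap_ext fun l => by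
    simp only [LinearMap.comp_apply, boundary_single, push_single]
    induction l with
    | nil => simp [boundaryList]
    | cons x l ih => simp [boundaryList, push_cone, ih]
  exact LinearMap.congr_fun this A

/-! ### Evaluation of cochains on pairs of chains -/

/-- The bilinear extension of a function of two lists. -/
def pairing (φ : List X → List Y → ZMod 2) :
    ListChain X →ₗ[ZMod 2] ListChain Y →ₗ[ZMod 2] ZMod 2 :=
  Finsupp.linearCombination (ZMod 2) fun l => Finsupp.linearCombination (ZMod 2) (φ l)

@[simp] lemma pairing_single (φ : List X → List Y → ZMod 2) (l : List X) (m : List Y) :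
    pairing φ (Finsupp.single l 1) (Finsupp.single m 1) = φ l m := by
  simp [pairing]

lemma bilinear_ext {F G : ListChain X →ₗ[ZMod 2] ListChain Y →ₗ[ZMod 2] ZMod 2}
    (h : ∀ l m, F (Finsupp.single l 1) (Finsupp.single m 1) =
      G (Finsupp.single l 1) (Finsupp.single m 1)) : F = G :=
  linearMap_ext fun l => linearMap_ext fun m => h l m

lemma pairing_eq_zero {φ : List X → List Y → ZMod 2} {A : ListChain X} {B : ListChain Y}
    (h : ∀ l ∈ A.support, ∀ m ∈ B.support, φ l m = 0) : pairing φ A B = 0 := by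
  simp only [pairing, Finsupp.linearCombination_apply, Finsupp.sum, LinearMap.sum_apply,
    LinearMap.smul_apply]
  refine Finset.sum_eq_zero fun l hl => ?_
  rw [Finset.sum_eq_zero fun m hm => by rw [h l hl m hm, smul_zero], smul_zero]

/-- The cup product `δt₁ ∪ ⋯ ∪ δtₙ` of the coboundaries of functions `tᵢ` on `X × Y`,
in the cochain bicomplex of `X` and `Y`. -/
def cup (t : ι → X → Y → ZMod 2) : List ι → List X → List Y → ZMod 2
  | [], [_], [_] => 1
  | i :: L, x :: l, y :: m =>
      (t i x y + t i (l.headD x) y) * cup t L l (y :: m) +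
        (t i x y + t i x (m.headD y)) * cup t L (x :: l) m
  | _, _, _ => 0

/-- The product of the function `s` evaluated at the initial vertices with `φ`. -/
def headMul (s : X → Y → ZMod 2) (φ : List X → List Y → ZMod 2) : List X → List Y → ZMod 2
  | x :: l, y :: m => s x y * φ (x :: l) (y :: m)
  | _, _ => 0

variable {t : ι → X → Y → ZMod 2}

@[simp] lemma cup_nil_left (L : List ι) (m : List Y) : cup t L [] m = 0 := by
  cases L <;> simp [cup]

@[simp] lemma cup_nil_right (L : List ι) (l : List X) : cup t L l [] = 0 := by
  cases L <;> cases l <;> simp [cup]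

@[simp] lemma headMul_nil_left (s : X → Y → ZMod 2) (φ : List X → List Y → ZMod 2) (m : List Y) :
    headMul s φ [] m = 0 := by
  simp [headMul]

@[simp] lemma headMul_nil_right (s : X → Y → ZMod 2) (φ : List X → List Y → ZMod 2)
    (l : List X) : headMul s φ l [] = 0 := by
  cases l <;> simp [headMul]

lemma pairing_headMul_cone_left (s : X → Y → ZMod 2) (φ : List X → List Y → ZMod 2)
    (x : X) (y : Y) (m : List Y) (A : ListChain X) :
    pairing (headMul s φ) (cone x A) (Finsupp.single (y :: m) 1) =
      s x y * pairing φ (cone x A) (Finsupp.single (y :: m) 1) := by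
  have : (pairing (headMul s φ)).flip (Finsupp.single (y :: m) 1) ∘ₗ cone x =
      s x y • ((pairing φ).flip (Finsupp.single (y :: m) 1) ∘ₗ cone x) :=
    linearMap_ext fun l => by simp [headMul]
  simpa using LinearMap.congr_fun this A

lemma pairing_headMul_cone_right (s : X → Y → ZMod 2) (φ : List X → List Y → ZMod 2)
    (x : X) (l : List X) (y : Y) (B : ListChain Y) :
    pairing (headMul s φ) (Finsupp.single (x :: l) 1) (cone y B) =
      s x y * pairing φ (Finsupp.single (x :: l) 1) (cone y B) := by
  have : pairing (headMul s φ) (Finsupp.single (x :: l) 1) ∘ₗ cone y =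
      s x y • (pairing φ (Finsupp.single (x :: l) 1) ∘ₗ cone y) :=
    linearMap_ext fun m => by simp [headMul]
  simpa using LinearMap.congr_fun this B

/-- A function of two lists is a cocycle for the total coboundary. -/
def IsCocycle (φ : List X → List Y → ZMod 2) : Prop :=
  ∀ A B, pairing φ (boundary A) B + pairing φ A (boundary B) = 0

lemma headMul_head (s : X → Y → ZMod 2) (L : List ι) (x : X) (l : List X) (y : Y) (m : List Y) :
    headMul s (cup t L) l (y :: m) = s (l.headD x) y * cup t L l (y :: m) := by
  cases l <;> simp [headMul]

lemma headMul_head' (s : X → Y → ZMod 2) (L : List ι) (x : X) (l : List X) (y : Y) (m : List Y) :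
    headMul s (cup t L) (x :: l) m = s x (m.headD y) * cup t L (x :: l) m := by
  cases m <;> simp [headMul]

lemma pairing_cup_cons {L : List ι} (hL : IsCocycle (cup t L)) (i : ι) (A : ListChain X)
    (B : ListChain Y) :
    pairing (cup t (i :: L)) A B =
      pairing (headMul (t i) (cup t L)) (boundary A) B +
        pairing (headMul (t i) (cup t L)) A (boundary B) := by
  have : pairing (cup t (i :: L)) = (pairing (headMul (t i) (cup t L))).comp boundary +
      (pairing (headMul (t i) (cup t L))).compl₂ boundary := by
    refine bilinear_ext fun l m => ?_
    have key := hL (Finsupp.single l 1) (Finsupp.single m 1)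
    rcases l with _ | ⟨x, l⟩
    · have h0 : ∀ B : ListChain Y,
          pairing (headMul (t i) (cup t L)) (Finsupp.single [] 1) B = 0 := fun B =>
        pairing_eq_zero fun l hl m _ => by
          rw [Finsupp.mem_support_single] at hl
          simp [hl.1]
      simp [boundaryList, h0]
    rcases m with _ | ⟨y, m⟩
    · have h0 : ∀ A : ListChain X,
          pairing (headMul (t i) (cup t L)) A (Finsupp.single [] 1) = 0 := fun A =>
        pairing_eq_zero fun l _ m hm => by
          rw [Finsupp.mem_support_single] at hm
          simp [hm.1]
      simp [boundaryList, h0]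
    simp only [LinearMap.add_apply, LinearMap.comp_apply, LinearMap.compl₂_apply,
      boundary_single, boundaryList, map_add, pairing_single, pairing_headMul_cone_left,
      pairing_headMul_cone_right, headMul_head _ _ x, headMul_head' _ _ _ _ y] at key ⊢
    rw [cup]
    linear_combination (-(t i x y)) * key + (t i x y) * CharTwo.add_self_eq_zero
      (cup t L l (y :: m) + cup t L (x :: l) m)
  simpa using LinearMap.congr_fun₂ this A B

lemma isCocycle_cup (L : List ι) : IsCocycle (cup t L) := by
  induction L with
  | nil =>
    intro A B
    have : (pairing (cup t [])).comp boundary + (pairing (cup t [])).compl₂ boundary = 0 := by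
      refine bilinear_ext fun l m => ?_
      simp only [LinearMap.add_apply, LinearMap.comp_apply, LinearMap.compl₂_apply,
        boundary_single, LinearMap.zero_apply]
      have hl : ∀ (l : List X) (m : List Y),
          pairing (cup t []) (boundaryList l) (Finsupp.single m 1) = 0 := by
        intro l m
        rcases l with _ | ⟨x, _ | ⟨x', _ | ⟨x'', l⟩⟩⟩
        · simp [boundaryList]
        · simp [boundaryList]
        · rcases m with _ | ⟨y, _ | ⟨y', m⟩⟩ <;>
            simp [boundaryList, cup, CharTwo.add_self_eq_zero]
        · have hc : ∀ z : X, ∀ A : ListChain X, pairing (cup t []) (cone x (cone z A))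
              (Finsupp.single m 1) = 0 := by
            intro z A
            have : (pairing (cup t [])).flip (Finsupp.single m 1) ∘ₗ cone x ∘ₗ cone z = 0 :=
              linearMap_ext fun l => by simp [cup]
            simpa using LinearMap.congr_fun this A
          simp [boundaryList, hc, cup]
      have hm : ∀ (l : List X) (m : List Y),
          pairing (cup t []) (Finsupp.single l 1) (boundaryList m) = 0 := by
        intro l m
        rcases m with _ | ⟨y, _ | ⟨y', _ | ⟨y'', m⟩⟩⟩
        · simp [boundaryList]
        · simp [boundaryList]
        · rcases l with _ | ⟨x, _ | ⟨x', l⟩⟩ <;>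
            simp [boundaryList, cup, CharTwo.add_self_eq_zero]
        · have hc : ∀ z : Y, ∀ B : ListChain Y, pairing (cup t []) (Finsupp.single l 1)
              (cone y (cone z B)) = 0 := by
            intro z B
            have : pairing (cup t []) (Finsupp.single l 1) ∘ₗ cone y ∘ₗ cone z = 0 :=
              linearMap_ext fun m => by simp [cup]
            simpa using LinearMap.congr_fun this B
          simp [boundaryList, hc, cup]
      rw [hl, hm, add_zero]
    simpa using LinearMap.congr_fun₂ this A B
  | cons i L ih =>
    intro A B
    simp only [pairing_cup_cons ih, boundary_boundary, map_zero, LinearMap.zero_apply]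
    rw [zero_add, add_zero, CharTwo.add_self_eq_zero]

/-- The cup product vanishes on a pair of lists on which one of the functions is constant. -/
lemma cup_eq_zero {i : ι} {r : ZMod 2} {L : List ι} (hi : i ∈ L) :
    ∀ {l : List X} {m : List Y}, (∀ x ∈ l, ∀ y ∈ m, t i x y = r) → cup t L l m = 0 := by
  induction L with
  | nil => simp at hi
  | cons i' L ih =>
    intro l m h
    rcases l with _ | ⟨x, l⟩
    · simp
    rcases m with _ | ⟨y, m⟩
    · simp
    rw [cup]
    rcases List.mem_cons.1 hi with rfl | hi
    · have h1 : t i (l.headD x) y = r := by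
        cases l with
        | nil => exact h _ (by simp) _ (by simp)
        | cons a l => exact h _ (by simp) _ (by simp)
      have h2 : t i x (m.headD y) = r := by
        cases m with
        | nil => exact h _ (by simp) _ (by simp)
        | cons a l => exact h _ (by simp) _ (by simp)
      rw [h1, h2, h x (by simp) y (by simp), CharTwo.add_self_eq_zero, zero_mul, zero_mul,
        add_zero]
    · rw [ih hi fun a ha b hb => h a (List.mem_cons_of_mem _ ha) b hb,
        ih hi fun a ha b hb => h a ha b (List.mem_cons_of_mem _ hb), mul_zero, mul_zero, add_zero]

/-! ### Evaluation on hemispheres -/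

lemma cup_map_left {g : X → X} {p : ι → ZMod 2} (hg : ∀ i x y, t i (g x) y = t i x y + p i)
    (L : List ι) (l : List X) (m : List Y) : cup t L (l.map g) m = cup t L l m := by
  induction L generalizing l m with
  | nil => rcases l with _ | ⟨x, _ | ⟨x', l⟩⟩ <;> rcases m with _ | ⟨y, _ | ⟨y', m⟩⟩ <;> simp [cup]
  | cons i L ih =>
    rcases l with _ | ⟨x, l⟩
    · simp
    rcases m with _ | ⟨y, m⟩
    · simp
    have e : (l.map g).headD (g x) = g (l.headD x) := by cases l <;> rfl
    have h2 := CharTwo.add_self_eq_zero (p i)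
    rw [List.map_cons, cup, cup, e, ih, ← List.map_cons, ih, hg, hg, hg]
    linear_combination (cup t L l (y :: m) + cup t L (x :: l) m) * h2

lemma cup_map_right {g : Y → Y} {q : ι → ZMod 2} (hg : ∀ i x y, t i x (g y) = t i x y + q i)
    (L : List ι) (l : List X) (m : List Y) : cup t L l (m.map g) = cup t L l m := by
  induction L generalizing l m with
  | nil => rcases l with _ | ⟨x, _ | ⟨x', l⟩⟩ <;> rcases m with _ | ⟨y, _ | ⟨y', m⟩⟩ <;> simp [cup]
  | cons i L ih =>
    rcases l with _ | ⟨x, l⟩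
    · simp
    rcases m with _ | ⟨y, m⟩
    · simp
    have e : (m.map g).headD (g y) = g (m.headD y) := by cases m <;> rfl
    have h2 := CharTwo.add_self_eq_zero (q i)
    rw [List.map_cons, cup, cup, e, ih, ← List.map_cons, ih, hg, hg, hg]
    linear_combination (cup t L l (y :: m) + cup t L (x :: l) m) * h2

lemma pairing_headMul_push_left {g : X → X} {p : ι → ZMod 2}
    (hg : ∀ i x y, t i (g x) y = t i x y + p i) (i : ι) (L : List ι) (A : ListChain X)
    (B : ListChain Y) :
    pairing (headMul (t i) (cup t L)) (A + push g A) B = p i * pairing (cup t L) A B := by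
  have : (pairing (headMul (t i) (cup t L))).comp (LinearMap.id + push g) =
      p i • pairing (cup t L) := by
    refine bilinear_ext fun l m => ?_
    rcases l with _ | ⟨x, l⟩
    · simp
    rcases m with _ | ⟨y, m⟩
    · simp
    have h1 := cup_map_left hg L (x :: l) (y :: m)
    rw [List.map_cons] at h1
    simp only [LinearMap.comp_apply, LinearMap.add_apply, LinearMap.id_apply, push_single,
      map_add, pairing_single, LinearMap.smul_apply, List.map_cons, headMul, smul_eq_mul, h1, hg]
    linear_combination (cup t L (x :: l) (y :: m)) * CharTwo.add_self_eq_zero (t i x y)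
  simpa using LinearMap.congr_fun₂ this A B

lemma pairing_headMul_push_right {g : Y → Y} {q : ι → ZMod 2}
    (hg : ∀ i x y, t i x (g y) = t i x y + q i) (i : ι) (L : List ι) (A : ListChain X)
    (B : ListChain Y) :
    pairing (headMul (t i) (cup t L)) A (B + push g B) = q i * pairing (cup t L) A B := by
  have : (pairing (headMul (t i) (cup t L))).compl₂ (LinearMap.id + push g) =
      q i • pairing (cup t L) := by
    refine bilinear_ext fun l m => ?_
    rcases l with _ | ⟨x, l⟩
    · simp
    rcases m with _ | ⟨y, m⟩
    · simp
    have h1 := cup_map_right hg L (x :: l) (y :: m)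
    rw [List.map_cons] at h1
    simp only [LinearMap.compl₂_apply, LinearMap.add_apply, LinearMap.id_apply, push_single,
      map_add, pairing_single, LinearMap.smul_apply, List.map_cons, headMul, smul_eq_mul, h1, hg]
    linear_combination (cup t L (x :: l) (y :: m)) * CharTwo.add_self_eq_zero (t i x y)
  simpa using LinearMap.congr_fun₂ this A B

/-- The coefficient of `e₁ ^ a * e₂ ^ b` in the product of the linear forms `p i * e₁ + q i * e₂`
over a list of indices `i` of length `a + b`. -/
def linearCoeff (p q : ι → ZMod 2) : List ι → ℕ → ℕ → ZMod 2
  | [], _, _ => 1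
  | _ :: _, 0, 0 => 0
  | i :: L, a + 1, 0 => p i * linearCoeff p q L a 0
  | i :: L, 0, b + 1 => q i * linearCoeff p q L 0 b
  | i :: L, a + 1, b + 1 => p i * linearCoeff p q L a (b + 1) + q i * linearCoeff p q L (a + 1) b

/-- A sequence of chains modelling the hemispheres of dimension `0, …, d` for the involution `g`:
the boundary of each one is the sum of the previous one and its image under `g`. -/
structure IsHemispheres (g : X → X) (d : ℕ) (D : ℕ → ListChain X) : Prop where
  zero : ∃ x, D 0 = Finsupp.single [x] 1
  succ : ∀ a < d, boundary (D (a + 1)) = D a + push g (D a)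

lemma pairing_cup_hemispheres {g : X → X} {h : Y → Y} {p q : ι → ZMod 2}
    (hg : ∀ i x y, t i (g x) y = t i x y + p i) (hh : ∀ i x y, t i x (h y) = t i x y + q i)
    {d : ℕ} {D : ℕ → ListChain X} {D' : ℕ → ListChain Y} (hD : IsHemispheres g d D)
    (hD' : IsHemispheres h d D') (L : List ι) :
    ∀ a b, a ≤ d → b ≤ d → a + b = L.length →
      pairing (cup t L) (D a) (D' b) = linearCoeff p q L a b := by
  obtain ⟨x, hx⟩ := hD.zero
  obtain ⟨y, hy⟩ := hD'.zero
  induction L with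
  | nil =>
    intro a b _ _ hab
    obtain ⟨rfl, rfl⟩ : a = 0 ∧ b = 0 := by simpa using hab
    simp [hx, hy, cup, linearCoeff]
  | cons i L ih =>
    have h0 : ∀ B : ListChain Y,
        pairing (headMul (t i) (cup t L)) (boundary (D 0)) B = 0 := fun B =>
      pairing_eq_zero fun l hl m _ => by
        simp only [hx, boundary_single, boundaryList, map_zero, add_zero] at hl
        rw [Finsupp.mem_support_single] at hl
        simp [hl.1]
    have h0' : ∀ A : ListChain X,
        pairing (headMul (t i) (cup t L)) A (boundary (D' 0)) = 0 := fun A =>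
      pairing_eq_zero fun l _ m hm => by
        simp only [hy, boundary_single, boundaryList, map_zero, add_zero] at hm
        rw [Finsupp.mem_support_single] at hm
        simp [hm.1]
    intro a b ha hb hab
    rw [pairing_cup_cons (isCocycle_cup L)]
    rw [List.length_cons] at hab
    rcases a with _ | a <;> rcases b with _ | b
    · omega
    · rw [h0, hD'.succ b (by omega), pairing_headMul_push_right hh, linearCoeff,
        ih 0 b (by omega) (by omega) (by omega), zero_add]
    · rw [h0', hD.succ a (by omega), pairing_headMul_push_left hg, linearCoeff,
        ih a 0 (by omega) (by omega) (by omega), add_zero]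
    · rw [hD.succ a (by omega), hD'.succ b (by omega), pairing_headMul_push_left hg,
        pairing_headMul_push_right hh, linearCoeff, ih a (b + 1) (by omega) (by omega) (by omega),
        ih (a + 1) b (by omega) (by omega) (by omega)]

end ListChain

namespace ListChain

/-! ### Barycentric subdivision -/

section Supported

variable {X Y : Type*}

lemma mem_supported_of_single {S : Set (List X)} {T : Set (List Y)}
    (F : ListChain X →ₗ[ZMod 2] ListChain Y)
    (hF : ∀ l ∈ S, F (Finsupp.single l 1) ∈ Finsupp.supported (ZMod 2) (ZMod 2) T)
    {A : ListChain X} (hA : A ∈ Finsupp.supported (ZMod 2) (ZMod 2) S) :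
    F A ∈ Finsupp.supported (ZMod 2) (ZMod 2) T := by
  rw [Finsupp.supported_eq_span_single] at hA
  induction hA using Submodule.span_induction with
  | mem x hx => obtain ⟨l, hl, rfl⟩ := hx; exact hF l hl
  | zero => simp
  | add x y _ _ hx hy => rw [map_add]; exact add_mem hx hy
  | smul r x _ hx => rw [map_smul]; exact Submodule.smul_mem _ _ hx

lemma cone_mem_supported {S T : Set (List X)} {x : X} (h : ∀ l ∈ S, x :: l ∈ T)
    {A : ListChain X} (hA : A ∈ Finsupp.supported (ZMod 2) (ZMod 2) S) :
    cone x A ∈ Finsupp.supported (ZMod 2) (ZMod 2) T :=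
  mem_supported_of_single _ (fun l hl => by
    rw [cone_single]; exact Finsupp.single_mem_supported _ _ (h l hl)) hA

lemma push_mem_supported {g : X → Y} {S : Set (List X)} {T : Set (List Y)}
    (h : ∀ l ∈ S, l.map g ∈ T)
    {A : ListChain X} (hA : A ∈ Finsupp.supported (ZMod 2) (ZMod 2) S) :
    push g A ∈ Finsupp.supported (ZMod 2) (ZMod 2) T :=
  mem_supported_of_single _ (fun l hl => by
    rw [push_single]; exact Finsupp.single_mem_supported _ _ (h l hl)) hA

lemma boundaryList_mem_supported (l : List X) :
    boundaryList l ∈ Finsupp.supported (ZMod 2) (ZMod 2)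
      {f : List X | f ⊆ l ∧ f.length + 1 = l.length} := by
  induction l with
  | nil => simp [boundaryList]
  | cons x l ih =>
    have h1 : l ∈ {f : List X | f ⊆ x :: l ∧ f.length + 1 = (x :: l).length} := by simp
    have h2 : ∀ f ∈ {f : List X | f ⊆ l ∧ f.length + 1 = l.length},
        x :: f ∈ {f : List X | f ⊆ x :: l ∧ f.length + 1 = (x :: l).length} :=
      fun f hf => ⟨List.cons_subset_cons x hf.1, by simpa using hf.2⟩
    exact add_mem (Finsupp.single_mem_supported _ _ h1) (cone_mem_supported h2 ih)

end Supported

variable {E : Type*} [NormedAddCommGroup E] [NormedSpace ℝ E]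

/-- The barycenter of a list of points. -/
def barycenter (l : List E) : E := (l.length : ℝ)⁻¹ • l.sum

lemma barycenter_map_neg (l : List E) : barycenter (l.map Neg.neg) = -barycenter l := by
  have : (l.map Neg.neg).sum = -l.sum := by
    induction l with
    | nil => simp
    | cons x l ih => simp only [List.map_cons, List.sum_cons, ih, neg_add]
  rw [barycenter, this, List.length_map, smul_neg, barycenter]

/-- Barycentric subdivision of chains of lists of length `n`. -/
def subdivide : ℕ → ListChain E →ₗ[ZMod 2] ListChain E
  | 0 => LinearMap.id
  | n + 1 => Finsupp.linearCombination (ZMod 2) fun l =>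
      cone (barycenter l) (subdivide n (boundaryList l))

lemma subdivide_succ_single (n : ℕ) (l : List E) :
    subdivide (n + 1) (Finsupp.single l 1) =
      cone (barycenter l) (subdivide n (boundaryList l)) := by
  simp [subdivide]

lemma boundary_subdivide (n : ℕ) (A : ListChain E) :
    boundary (subdivide (n + 1) A) = subdivide n (boundary A) := by
  induction n generalizing A with
  | zero =>
    have : boundary ∘ₗ subdivide (E := E) 1 = subdivide 0 ∘ₗ boundary :=
      linearMap_ext fun l => by
        simp [boundary_cone, subdivide, boundary_boundaryList]
    exact LinearMap.congr_fun this A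
  | succ n ih =>
    have : boundary ∘ₗ subdivide (E := E) (n + 2) = subdivide (n + 1) ∘ₗ boundary :=
      linearMap_ext fun l => by
        simp [subdivide_succ_single, boundary_cone, ih, boundary_boundaryList]
    exact LinearMap.congr_fun this A

lemma subdivide_push_neg (n : ℕ) (A : ListChain E) :
    subdivide n (push Neg.neg A) = push Neg.neg (subdivide n A) := by
  induction n generalizing A with
  | zero => simp [subdivide]
  | succ n ih =>
    have : subdivide (E := E) (n + 1) ∘ₗ push Neg.neg = push Neg.neg ∘ₗ subdivide (n + 1) :=
      linearMap_ext fun l => by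
        have := push_boundary Neg.neg (Finsupp.single l 1)
        rw [boundary_single, push_single, boundary_single] at this
        simp only [LinearMap.comp_apply, push_single, subdivide_succ_single, push_cone, ← ih,
          this, barycenter_map_neg]
    exact LinearMap.congr_fun this A

/-- The lists of `n` points of the convex set `C` at mutual distances at most `δ`. -/
def smallLists (n : ℕ) (C : Set E) (δ : ℝ) : Set (List E) :=
  {l | l.length = n ∧ (∀ x ∈ l, x ∈ C) ∧ ∀ x ∈ l, ∀ y ∈ l, dist x y ≤ δ}

lemma barycenter_mem {l : List E} (hl : l ≠ []) {C : Set E} (hC : Convex ℝ C)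
    (h : ∀ x ∈ l, x ∈ C) : barycenter l ∈ C := by
  have hpos : (0 : ℝ) < l.length := by
    exact_mod_cast List.length_pos_iff.2 hl
  have hsum : l.sum = ∑ i : Fin l.length, l[i] := by simp
  rw [barycenter, hsum, Finset.smul_sum]
  refine hC.sum_mem (fun _ _ => by positivity) ?_ (fun i _ => h _ (List.getElem_mem _))
  simp [hpos.ne']

lemma dist_barycenter_le {l : List E} {x : E} (hx : x ∈ l) {δ : ℝ}
    (h : ∀ y ∈ l, dist x y ≤ δ) : dist x (barycenter l) ≤ (1 - (l.length : ℝ)⁻¹) * δ := by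
  have hpos : (0 : ℝ) < l.length := by
    exact_mod_cast List.length_pos_of_mem hx
  have key : ∀ m : List E, (∀ y ∈ m, dist x y ≤ δ) →
      ‖(m.length : ℝ) • x - m.sum‖ ≤ m.length * δ := by
    intro m hm
    induction m with
    | nil => simp
    | cons y m ih =>
      have h1 := ih fun z hz => hm z (List.mem_cons_of_mem _ hz)
      have h2 := hm y List.mem_cons_self
      rw [dist_eq_norm] at h2
      have : ((y :: m).length : ℝ) • x - (y :: m).sum =
          ((m.length : ℝ) • x - m.sum) + (x - y) := by
        simp only [List.length_cons, List.sum_cons]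
        push_cast
        module
      rw [this]
      refine (norm_add_le _ _).trans ?_
      simp only [List.length_cons]
      push_cast
      linarith
  obtain ⟨s, r, rfl⟩ := List.append_of_mem hx
  have h1 := key (s ++ r) fun y hy => h y (by
    rcases List.mem_append.1 hy with hy | hy <;> simp [hy])
  set n : ℝ := ((s ++ x :: r).length : ℝ) with hn
  have hn' : n = (s ++ r).length + 1 := by
    rw [hn]; simp only [List.length_append, List.length_cons]; push_cast; ring
  have : x - barycenter (s ++ x :: r) = n⁻¹ • (((s ++ r).length : ℝ) • x - (s ++ r).sum) := by
    have hs : (s ++ x :: r).sum = x + (s ++ r).sum := by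
      simp only [List.sum_append, List.sum_cons]; abel
    rw [barycenter, hs, ← hn, smul_sub, smul_smul, smul_add]
    have : ((s ++ r).length : ℝ) = n - 1 := by linarith
    rw [this, mul_sub, inv_mul_cancel₀ hpos.ne', sub_smul, mul_one]
    module
  rw [dist_eq_norm, this, norm_smul, Real.norm_of_nonneg (by positivity)]
  have h3 : ((s ++ r).length : ℝ) = n - 1 := by linarith
  rw [h3] at h1
  calc n⁻¹ * _ ≤ n⁻¹ * ((n - 1) * δ) := by
        have := h1
        rw [h3]
        gcongr
    _ = (1 - n⁻¹) * δ := by field_simp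

lemma subdivide_mem_supported {N n : ℕ} (hn : n ≤ N) {C : Set E} (hC : Convex ℝ C) {δ : ℝ}
    {l : List E} (hl : l ∈ smallLists n C δ) :
    subdivide n (Finsupp.single l 1) ∈ Finsupp.supported (ZMod 2) (ZMod 2)
      (smallLists n C ((1 - (N : ℝ)⁻¹) * δ)) := by
  induction n generalizing C l with
  | zero =>
    obtain rfl := List.length_eq_zero_iff.1 hl.1
    exact Finsupp.single_mem_supported _ _ ⟨rfl, by simp, by simp⟩
  | succ n ih =>
    have hne : l ≠ [] := by
      rintro rfl
      simpa using hl.1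
    have hδ : 0 ≤ δ := by
      obtain ⟨x, hx⟩ := List.exists_mem_of_ne_nil l hne
      simpa using hl.2.2 x hx x hx
    have hr : (1 - (l.length : ℝ)⁻¹) * δ ≤ (1 - (N : ℝ)⁻¹) * δ := by
      have : (N : ℝ)⁻¹ ≤ (l.length : ℝ)⁻¹ := by
        rw [hl.1]
        gcongr
      gcongr
    have hr0 : 0 ≤ (1 - (N : ℝ)⁻¹) * δ := by
      have : (N : ℝ)⁻¹ ≤ 1 := Nat.cast_inv_le_one N
      have : 0 ≤ 1 - (N : ℝ)⁻¹ := by linarith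
      positivity
    have hball : ∀ y ∈ convexHull ℝ {x | x ∈ l},
        dist y (barycenter l) ≤ (1 - (N : ℝ)⁻¹) * δ := fun y hy =>
      convexHull_min (t := Metric.closedBall (barycenter l) ((1 - (N : ℝ)⁻¹) * δ))
        (fun x hx => (dist_barycenter_le hx (hl.2.2 x hx)).trans hr) (convex_closedBall _ _) hy
    have hsub : convexHull ℝ {x | x ∈ l} ⊆ C := convexHull_min (fun x hx => hl.2.1 x hx) hC
    rw [subdivide_succ_single]
    refine cone_mem_supported (S := smallLists n (convexHull ℝ {x | x ∈ l}) _) ?_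
      (mem_supported_of_single _ (fun f hf => ih (by omega) (convex_convexHull ℝ _) ?_)
        (boundaryList_mem_supported l))
    · rintro m ⟨h1, h2, h3⟩
      refine ⟨by simp [h1], ?_, ?_⟩
      · intro x hx
        rcases List.mem_cons.1 hx with rfl | hx
        · exact barycenter_mem hne hC hl.2.1
        · exact hsub (h2 x hx)
      · intro x hx y hy
        rcases List.mem_cons.1 hx with rfl | hx <;> rcases List.mem_cons.1 hy with rfl | hy
        · simpa using hr0
        · rw [dist_comm]; exact hball y (h2 y hy)
        · exact hball x (h2 x hx)
        · exact h3 x hx y hy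
    · refine ⟨by have := hf.2; have := hl.1; omega, fun x hx => subset_convexHull ℝ _ (hf.1 hx),
        fun x hx y hy => hl.2.2 x (hf.1 hx) y (hf.1 hy)⟩

end ListChain

/-! ### The polynomials `piF2` -/

lemma piF2_one : piF2 1 = X 0 := by
  simp [piF2]

lemma piF2_zero : piF2 0 = 0 := by
  simp [piF2]

lemma piF2_add_two (n : ℕ) : piF2 (n + 2) = X 0 * piF2 (n + 1) + X 1 * piF2 n := by
  have h1 : piF2 (n + 2) = X 0 ^ (n + 2) + ∑ i ∈ Finset.range (n + 1),
      if 2 * i + 1 ≤ n then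
        C (((n - i).choose (i + 1) : ZMod 2)) * X 1 ^ (i + 1) * X 0 ^ (n - 2 * i) else 0 := by
    rw [piF2, Finset.sum_range_succ', Finset.sum_range_succ, add_comm]
    congr 1
    · simp
    · rw [if_neg (by omega), add_zero]
      refine Finset.sum_congr rfl fun i _ => ?_
      by_cases h : 2 * i + 1 ≤ n
      · rw [if_pos h, if_pos (by omega), show n + 2 - 1 - (i + 1) = n - i by omega,
          show n + 2 - 2 * (i + 1) = n - 2 * i by omega]
      · rw [if_neg h, if_neg (by omega)]
  have h2 : X 0 * piF2 (n + 1) = X 0 ^ (n + 2) + ∑ i ∈ Finset.range (n + 1),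
      if 2 * i + 1 ≤ n then
        C (((n - 1 - i).choose (i + 1) : ZMod 2)) * X 1 ^ (i + 1) * X 0 ^ (n - 2 * i) else 0 := by
    rw [piF2, Finset.sum_range_succ', mul_add, add_comm]
    congr 1
    · simp [pow_succ']
    · rw [Finset.mul_sum]
      refine Finset.sum_congr rfl fun i _ => ?_
      by_cases h : 2 * i + 1 ≤ n
      · rw [if_pos h]
        by_cases h' : 2 * (i + 1) + 1 ≤ n + 1
        · rw [if_pos h', show n + 1 - 1 - (i + 1) = n - 1 - i by omega,
            show n - 2 * i = n + 1 - 2 * (i + 1) + 1 by omega]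
          ring
        · rw [if_neg h', Nat.choose_eq_zero_of_lt (by omega)]
          simp
      · rw [if_neg h, if_neg (by omega), mul_zero]
  rw [h1, h2, piF2, Finset.mul_sum, add_assoc, ← Finset.sum_add_distrib]
  congr 1
  refine Finset.sum_congr rfl fun i _ => ?_
  by_cases h : 2 * i + 1 ≤ n
  · rw [if_pos h, if_pos h, if_pos h, show n - i = n - 1 - i + 1 by omega,
      Nat.choose_succ_succ]
    push_cast
    rw [C_add]
    ring
  · rw [if_neg h, if_neg h, if_neg h, mul_zero, add_zero]

/-- In terms of the roots `e₁`, `e₂` of `T ^ 2 + y T + w`, the polynomial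
`e₁ ^ a * e₂ ^ b + e₁ ^ b * e₂ ^ a` if `b < a`, and `0` otherwise. -/
def halfMonomial (b a : ℕ) : MvPolynomial (Fin 2) (ZMod 2) :=
  if b < a then X 1 ^ b * piF2 (a - b) else 0

lemma X_zero_mul_halfMonomial {b a : ℕ} (h : b ≠ a) :
    X 0 * halfMonomial b a = halfMonomial b (a + 1) + halfMonomial (b + 1) a := by
  rcases lt_or_gt_of_ne h with h | h
  · obtain ⟨n, rfl⟩ := Nat.exists_eq_add_of_lt h
    have e := piF2_add_two n
    have h2 : halfMonomial (b + 1) (b + n + 1) = X 1 ^ (b + 1) * piF2 n := by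
      rw [halfMonomial, show b + n + 1 - (b + 1) = n by omega]
      rcases n with _ | n
      · simp [piF2_zero]
      · rw [if_pos (by omega)]
    rw [h2, halfMonomial, halfMonomial, if_pos (by omega), if_pos (by omega),
      show b + n + 1 - b = n + 1 by omega, show b + n + 1 + 1 - b = n + 2 by omega, e]
    have := CharTwo.add_self_eq_zero (X 1 ^ (b + 1) * piF2 n)
    linear_combination -this
  · rw [halfMonomial, halfMonomial, halfMonomial, if_neg (by omega), if_neg (by omega),
      if_neg (by omega)]
    simp

lemma X_zero_pow_eq_sum (j : ℕ) (hj : 1 ≤ j) :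
    (X 0 : MvPolynomial (Fin 2) (ZMod 2)) ^ j =
      ∑ p ∈ Finset.HasAntidiagonal.antidiagonal j, (j.choose p.1 : MvPolynomial (Fin 2) (ZMod 2)) *
        halfMonomial p.1 p.2 := by
  induction j, hj using Nat.le_induction with
  | base => simp [halfMonomial, piF2_one, Finset.Nat.antidiagonal_succ]
  | succ j hj ih =>
    rw [Finset.sum_antidiagonal_choose_succ_mul, ← Finset.sum_add_distrib, pow_succ', ih,
      Finset.mul_sum]
    refine Finset.sum_congr rfl fun p hp => ?_
    have hp := Finset.HasAntidiagonal.mem_antidiagonal.1 hp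
    have hsymm : j.choose p.2 = j.choose p.1 := by
      rw [← hp, Nat.choose_symm_add]
    rw [hsymm, ← mul_add]
    by_cases h : p.1 = p.2
    · have : (j.choose p.1 : MvPolynomial (Fin 2) (ZMod 2)) = 0 := by
        have : 2 ∣ j.choose p.1 := by
          rw [← hp, ← h, ← two_mul]
          exact Nat.two_dvd_centralBinom_of_one_le (by omega)
        exact (CharP.cast_eq_zero_iff _ 2 _).2 this
      rw [this]
      simp
    · rw [← X_zero_mul_halfMonomial h]
      ring

lemma piF2_mem_span {d n : ℕ} (h : d + 1 ≤ n) :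
    piF2 n ∈ Ideal.span {piF2 (d + 1), piF2 (d + 2)} := by
  have : ∀ m, piF2 (d + 1 + m) ∈ Ideal.span {piF2 (d + 1), piF2 (d + 2)} ∧
      piF2 (d + 1 + m + 1) ∈ Ideal.span {piF2 (d + 1), piF2 (d + 2)} := by
    intro m
    induction m with
    | zero => exact ⟨Ideal.subset_span (by simp), Ideal.subset_span (by simp)⟩
    | succ m ih =>
      refine ⟨ih.2, ?_⟩
      rw [show d + 1 + (m + 1) + 1 = d + 1 + m + 2 by omega, piF2_add_two (d + 1 + m)]
      exact add_mem (Ideal.mul_mem_left _ _ ih.2) (Ideal.mul_mem_left _ _ ih.1)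
  obtain ⟨m, rfl⟩ := Nat.exists_eq_add_of_le h
  exact (this m).1

lemma halfMonomial_mem_span {d a : ℕ} (h : d + 1 ≤ a) (b : ℕ) :
    halfMonomial b a ∈ Ideal.span {piF2 (d + 1), piF2 (d + 2)} := by
  induction b generalizing a with
  | zero =>
    rw [halfMonomial, if_pos (by omega), pow_zero, one_mul]
    exact piF2_mem_span h
  | succ b ih =>
    by_cases hb : b = a
    · rw [halfMonomial, if_neg (by omega)]
      exact zero_mem _
    · rw [show halfMonomial (b + 1) a = X 0 * halfMonomial b a - halfMonomial b (a + 1) by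
        rw [X_zero_mul_halfMonomial hb]; ring]
      exact sub_mem (Ideal.mul_mem_left _ _ (ih h)) (ih (by omega))

lemma exists_odd_choose_of_not_mem_span {d j : ℕ} (hj : 1 ≤ j)
    (h : (X 0 : MvPolynomial (Fin 2) (ZMod 2)) ^ j * X 1 ^ j ∉
      Ideal.span {piF2 (d + 1), piF2 (d + 2)}) :
    ∃ a b, a + b = j ∧ j + a ≤ d ∧ j + b ≤ d ∧ (j.choose a : ZMod 2) ≠ 0 := by
  contrapose! h
  rw [X_zero_pow_eq_sum j hj, Finset.sum_mul]
  refine sum_mem fun p hp => ?_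
  have hp := Finset.HasAntidiagonal.mem_antidiagonal.1 hp
  have hmul : halfMonomial p.1 p.2 * X 1 ^ j = halfMonomial (j + p.1) (j + p.2) := by
    by_cases hlt : p.1 < p.2
    · rw [halfMonomial, halfMonomial, if_pos hlt, if_pos (by omega), Nat.add_sub_add_left]
      ring
    · rw [halfMonomial, halfMonomial, if_neg hlt, if_neg (by omega), zero_mul]
  rw [mul_assoc, hmul]
  by_cases hlt : p.1 < p.2
  · by_cases hd : d + 1 ≤ j + p.2
    · exact Ideal.mul_mem_left _ _ (halfMonomial_mem_span hd _)
    · have h0 := h p.1 p.2 hp (by omega) (by omega)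
      have : (j.choose p.1 : MvPolynomial (Fin 2) (ZMod 2)) = 0 := by
        rw [← map_natCast (C : ZMod 2 →+* MvPolynomial (Fin 2) (ZMod 2)), h0, map_zero]
      rw [this, zero_mul]
      exact zero_mem _
  · rw [halfMonomial, if_neg (by omega), mul_zero]
    exact zero_mem _

namespace ListChain

/-! ### Small hemispheres -/

section Push

variable {X Y Z : Type*}

lemma push_push (g : Y → Z) (f : X → Y) (A : ListChain X) :
    push g (push f A) = push (g ∘ f) A := by
  have : push g ∘ₗ push f = push (g ∘ f) := linearMap_ext fun l => by simp
  exact LinearMap.congr_fun this A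

lemma push_congr {f g : X → Y} {A : ListChain X}
    (h : ∀ l ∈ A.support, ∀ x ∈ l, f x = g x) : push f A = push g A :=
  Finsupp.mapDomain_congr fun l hl => List.map_congr_left (h l hl)

lemma push_neg_push_neg {E : Type*} [InvolutiveNeg E] (A : ListChain E) :
    push Neg.neg (push Neg.neg A) = A := by
  have : push Neg.neg ∘ₗ push Neg.neg = (LinearMap.id : ListChain E →ₗ[ZMod 2] _) :=
    linearMap_ext fun l => by simp
  exact LinearMap.congr_fun this A

end Push

section CrossHemisphere

variable {E : Type*} [InvolutiveNeg E]

/-- The hemispheres of the boundary of the cross-polytope with vertices `± e k`. -/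
def crossHemisphere (e : ℕ → E) : ℕ → ListChain E
  | 0 => Finsupp.single [e 0] 1
  | k + 1 => cone (e (k + 1)) (crossHemisphere e k + push Neg.neg (crossHemisphere e k))

lemma boundary_crossHemisphere (e : ℕ → E) (k : ℕ) :
    boundary (crossHemisphere e (k + 1)) =
      crossHemisphere e k + push Neg.neg (crossHemisphere e k) := by
  have : boundary (crossHemisphere e k + push Neg.neg (crossHemisphere e k)) = 0 := by
    rw [map_add, ← push_boundary]
    cases k with
    | zero => simp [crossHemisphere, boundaryList, add_self_eq_zero]
    | succ k =>
      rw [boundary_crossHemisphere e k, map_add, push_neg_push_neg,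
        add_comm (push Neg.neg _), add_self_eq_zero]
  rw [crossHemisphere, boundary_cone, this, map_zero, add_zero]

end CrossHemisphere

variable {E : Type*} [NormedAddCommGroup E] [NormedSpace ℝ E]

/-- The simplices of the hemispheres of a cross-polytope lie in affine hyperplanes
missing the origin. -/
lemma crossHemisphere_mem_supported {e : ℕ → E} {φ : ℕ → E →ₗ[ℝ] ℝ} {d : ℕ}
    (h : ∀ i ≤ d, ∀ k ≤ d, φ i (e k) = if i = k then 1 else 0) {k : ℕ} (hk : k ≤ d) :
    crossHemisphere e k ∈ Finsupp.supported (ZMod 2) (ZMod 2)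
      {l | l.length = k + 1 ∧ (∃ ψ : E →ₗ[ℝ] ℝ, ∀ x ∈ l, ψ x = 1) ∧
        ∀ x ∈ l, ∀ i, k < i → i ≤ d → φ i x = 0} := by
  induction k with
  | zero =>
    refine Finsupp.single_mem_supported _ _ ⟨rfl, ⟨φ 0, by simp [h]⟩, ?_⟩
    simp only [List.mem_singleton, forall_eq]
    intro i hi hid
    rw [h i hid 0 hk, if_neg (by omega)]
  | succ k ih =>
    have ih := ih (by omega)
    refine cone_mem_supported ?_ (add_mem ih (push_mem_supported ?_ ih))
    · rintro l ⟨h1, ⟨ψ, hψ⟩, h2⟩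
      refine ⟨by simp [h1], ⟨ψ + (1 - ψ (e (k + 1))) • φ (k + 1), ?_⟩, ?_⟩
      · intro x hx
        rcases List.mem_cons.1 hx with rfl | hx
        · simp [h (k + 1) hk (k + 1) hk]
        · simp [hψ x hx, h2 x hx (k + 1) (by omega) hk]
      · intro x hx i hi hid
        rcases List.mem_cons.1 hx with rfl | hx
        · rw [h i hid (k + 1) hk, if_neg (by omega)]
        · exact h2 x hx i (by omega) hid
    · rintro l ⟨h1, ⟨ψ, hψ⟩, h2⟩
      refine ⟨by simp [h1], ⟨-ψ, ?_⟩, ?_⟩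
      · intro x hx
        obtain ⟨y, hy, rfl⟩ := List.mem_map.1 hx
        simp [hψ y hy]
      · intro x hx i hi hid
        obtain ⟨y, hy, rfl⟩ := List.mem_map.1 hx
        simp [h2 y hy i hi hid]

/-- Hemispheres of the boundary of a cross-polytope, subdivided `m` times. -/
def subdividedHemisphere (e : ℕ → E) : ℕ → ℕ → ListChain E
  | 0, k => crossHemisphere e k
  | m + 1, k => subdivide (k + 1) (subdividedHemisphere e m k)

lemma isHemispheres_subdividedHemisphere (e : ℕ → E) (m d : ℕ) :
    IsHemispheres Neg.neg d (subdividedHemisphere e m) := by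
  induction m with
  | zero => exact ⟨⟨e 0, rfl⟩, fun a _ => boundary_crossHemisphere e a⟩
  | succ m ih =>
    obtain ⟨x, hx⟩ := ih.zero
    refine ⟨⟨x, ?_⟩, fun a ha => ?_⟩
    · rw [subdividedHemisphere, hx]
      simp [subdivide, boundaryList, barycenter]
    · simp only [subdividedHemisphere]
      rw [boundary_subdivide, ih.succ a ha, map_add, subdivide_push_neg]

lemma exists_small_subdividedHemisphere {e : ℕ → E} {φ : ℕ → E →ₗ[ℝ] ℝ} {d : ℕ}
    (h : ∀ i ≤ d, ∀ k ≤ d, φ i (e k) = if i = k then 1 else 0) :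
    ∃ K : Set E, IsCompact K ∧ 0 ∉ K ∧ ∀ δ > 0, ∃ m, ∀ k ≤ d,
      ∀ l ∈ (subdividedHemisphere e m k).support,
        (∀ x ∈ l, x ∈ K) ∧ ∀ x ∈ l, ∀ y ∈ l, dist x y < δ := by
  set K : Set E := ⋃ k ∈ Finset.range (d + 1), ⋃ l ∈ (crossHemisphere e k).support,
    convexHull ℝ {x | x ∈ l} with hK
  have hKc : IsCompact K := by
    refine Finset.isCompact_biUnion _ fun k _ => Finset.isCompact_biUnion _ fun l _ => ?_
    exact (List.finite_toSet l).isCompact_convexHull ℝ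
  have hK0 : (0 : E) ∉ K := by
    simp only [hK, Set.mem_iUnion, not_exists]
    intro k hk l hl h0
    obtain ⟨-, ⟨ψ, hψ⟩, -⟩ :=
      (crossHemisphere_mem_supported h (Nat.lt_succ_iff.1 (Finset.mem_range.1 hk))) hl
    have : convexHull ℝ {x | x ∈ l} ⊆ {x | ψ x = 1} :=
      convexHull_min hψ (convex_hyperplane ψ.isLinear 1)
    simpa using this h0
  refine ⟨K, hKc, hK0, fun δ hδ => ?_⟩
  set r : ℝ := 1 - ((d + 1 : ℕ) : ℝ)⁻¹ with hr
  have hr0 : 0 ≤ r := by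
    have := Nat.cast_inv_le_one (α := ℝ) (d + 1)
    rw [hr]; linarith
  have hr1 : r < 1 := by
    have : (0 : ℝ) < ((d + 1 : ℕ) : ℝ)⁻¹ := by positivity
    rw [hr]; linarith
  have key : ∀ m, ∀ k ≤ d, subdividedHemisphere e m k ∈ Finsupp.supported (ZMod 2) (ZMod 2)
      {l | ∃ C : Set E, Convex ℝ C ∧ C ⊆ K ∧
        l ∈ smallLists (k + 1) C (r ^ m * Metric.diam K)} := by
    intro m k hk
    induction m with
    | zero =>
      intro l hl
      have hsub : convexHull ℝ {x | x ∈ l} ⊆ K := by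
        intro y hy
        simp only [hK, Set.mem_iUnion]
        exact ⟨k, Finset.mem_range.2 (by omega), l, hl, hy⟩
      have hmem : ∀ x ∈ l, x ∈ convexHull ℝ {x | x ∈ l} := fun x hx =>
        subset_convexHull ℝ _ hx
      refine ⟨_, convex_convexHull ℝ {x | x ∈ l}, hsub,
        (crossHemisphere_mem_supported h hk hl).1, hmem, fun x hx y hy => ?_⟩
      rw [pow_zero, one_mul]
      exact Metric.dist_le_diam_of_mem hKc.isBounded (hsub (hmem x hx)) (hsub (hmem y hy))
    | succ m ih =>
      refine mem_supported_of_single _ ?_ ih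
      rintro l ⟨C, hC, hCK, hl⟩
      refine Finsupp.supported_mono ?_ (subdivide_mem_supported (N := d + 1) (by omega) hC hl)
      intro l' hl'
      rw [← mul_assoc, ← hr, ← pow_succ'] at hl'
      exact ⟨C, hC, hCK, hl'⟩
  have hlim : Filter.Tendsto (fun m => r ^ m * Metric.diam K) Filter.atTop (nhds 0) := by
    simpa using (tendsto_pow_atTop_nhds_zero_of_lt_one hr0 hr1).mul_const (Metric.diam K)
  obtain ⟨m, hm⟩ := (hlim.eventually (gt_mem_nhds hδ)).exists
  refine ⟨m, fun k hk l hl => ?_⟩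
  obtain ⟨C, -, hCK, -, h1, h2⟩ := key m k hk hl
  exact ⟨fun x hx => hCK (h1 x hx), fun x hx y hy => (h2 x hx y hy).trans_lt hm⟩

/-- The unit sphere of `ℝ ^ (d + 1)` carries hemispheres made of arbitrarily small simplices. -/
lemma exists_small_hemispheres (d : ℕ) {ε : ℝ} (hε : 0 < ε) :
    ∃ D : ℕ → ListChain (Metric.sphere (0 : EuclideanSpace ℝ (Fin (d + 1))) 1),
      IsHemispheres Neg.neg d D ∧
        ∀ a ≤ d, ∀ l ∈ (D a).support, ∀ x ∈ l, ∀ y ∈ l, dist x y < ε := by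
  let e : ℕ → EuclideanSpace ℝ (Fin (d + 1)) := fun k =>
    EuclideanSpace.single (Fin.ofNat (d + 1) k) 1
  let φ : ℕ → EuclideanSpace ℝ (Fin (d + 1)) →ₗ[ℝ] ℝ := fun i =>
    (EuclideanSpace.proj (Fin.ofNat (d + 1) i)).toLinearMap
  have hφ : ∀ i ≤ d, ∀ k ≤ d, φ i (e k) = if i = k then 1 else 0 := by
    intro i hi k hk
    have : (Fin.ofNat (d + 1) i = Fin.ofNat (d + 1) k) ↔ i = k := by
      rw [Fin.ext_iff]
      simp only [Fin.ofNat]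
      rw [Nat.mod_eq_of_lt (by omega), Nat.mod_eq_of_lt (by omega)]
    have hs : φ i (e k) = if Fin.ofNat (d + 1) i = Fin.ofNat (d + 1) k then 1 else 0 := by
      simp [φ, e]
    rw [hs]
    simp only [this]
  obtain ⟨K, hK, hK0, hsmall⟩ := exists_small_subdividedHemisphere hφ
  have hcont : ContinuousOn (fun x : EuclideanSpace ℝ (Fin (d + 1)) => ‖x‖⁻¹ • x) K :=
    (continuous_norm.continuousOn.inv₀ fun x hx => norm_ne_zero_iff.2 fun h0 =>
      hK0 (h0 ▸ hx)).smul continuousOn_id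
  obtain ⟨δ, hδ, hunif⟩ := Metric.uniformContinuousOn_iff.1
    (hK.uniformContinuousOn_of_continuous hcont) ε hε
  obtain ⟨m, hm⟩ := hsmall δ hδ
  let n : EuclideanSpace ℝ (Fin (d + 1)) → Metric.sphere (0 : EuclideanSpace ℝ (Fin (d + 1))) 1 :=
    fun x => if hx : x = 0 then ⟨e 0, by simp [e]⟩ else
      ⟨‖x‖⁻¹ • x, by simp [norm_smul, norm_ne_zero_iff.2 hx]⟩
  have hn : ∀ x, x ≠ 0 → (n x : EuclideanSpace ℝ (Fin (d + 1))) = ‖x‖⁻¹ • x := fun x hx => by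
    simp only [n, dif_neg hx]
  have hH := isHemispheres_subdividedHemisphere e m d
  refine ⟨fun k => push n (subdividedHemisphere e m k), ⟨?_, fun a ha => ?_⟩, ?_⟩
  · obtain ⟨x, hx⟩ := hH.zero
    exact ⟨n x, by simp [hx]⟩
  · rw [← push_boundary, hH.succ a ha, map_add, push_push, push_push]
    congr 1
    refine push_congr fun l hl x hx => ?_
    have hx0 : x ≠ 0 := fun h0 => hK0 (h0 ▸ (hm a ha.le l hl).1 x hx)
    refine Subtype.ext ?_
    change (n (-x) : EuclideanSpace ℝ (Fin (d + 1))) = -(n x : EuclideanSpace ℝ (Fin (d + 1)))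
    rw [hn x hx0, hn (-x) (neg_ne_zero.2 hx0), norm_neg, smul_neg]
  · intro a ha
    have : push n (subdividedHemisphere e m a) ∈ Finsupp.supported (ZMod 2) (ZMod 2)
        {l | ∀ x ∈ l, ∀ y ∈ l, dist x y < ε} := by
      refine push_mem_supported (S := {l | (∀ x ∈ l, x ∈ K) ∧ ∀ x ∈ l, ∀ y ∈ l, dist x y < δ})
        ?_ (fun l hl => hm a ha l hl)
      rintro l ⟨h1, h2⟩ x' hx' y' hy'
      obtain ⟨x, hx, rfl⟩ := List.mem_map.1 hx'
      obtain ⟨y, hy, rfl⟩ := List.mem_map.1 hy'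
      rw [Subtype.dist_eq, hn x fun h0 => hK0 (h0 ▸ h1 x hx), hn y fun h0 => hK0 (h0 ▸ h1 y hy)]
      exact hunif x (h1 x hx) y (h1 y hy) (h2 x hx y hy)
    exact fun l hl => this hl

end ListChain

namespace ListChain

variable {ι : Type*}

/-! ### Coefficients of products of linear forms -/

lemma linearCoeff_append_left {p q : ι → ZMod 2} {L : List ι} (h : ∀ i ∈ L, p i = 1 ∧ q i = 0)
    (L' : List ι) (a b : ℕ) :
    linearCoeff p q (L ++ L') (L.length + a) b = linearCoeff p q L' a b := by
  induction L with
  | nil => simp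
  | cons i L ih =>
    have hi := h i List.mem_cons_self
    have ih := ih fun k hk => h k (List.mem_cons_of_mem _ hk)
    rw [List.cons_append, List.length_cons, add_right_comm]
    cases b <;> rw [linearCoeff, ih, hi.1, one_mul]
    rw [hi.2, zero_mul, add_zero]

lemma linearCoeff_append_right {p q : ι → ZMod 2} {L : List ι} (h : ∀ i ∈ L, p i = 0 ∧ q i = 1)
    (L' : List ι) (a b : ℕ) :
    linearCoeff p q (L ++ L') a (L.length + b) = linearCoeff p q L' a b := by
  induction L with
  | nil => simp
  | cons i L ih =>
    have hi := h i List.mem_cons_self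
    have ih := ih fun k hk => h k (List.mem_cons_of_mem _ hk)
    rw [List.cons_append, List.length_cons, add_right_comm]
    cases a <;> rw [linearCoeff, ih, hi.2, one_mul]
    rw [hi.1, zero_mul, zero_add]

lemma linearCoeff_eq_choose {p q : ι → ZMod 2} {L : List ι} (h : ∀ i ∈ L, p i = 1 ∧ q i = 1)
    {a b : ℕ} (hab : a + b = L.length) :
    linearCoeff p q L a b = (L.length.choose a : ZMod 2) := by
  induction L generalizing a b with
  | nil =>
    obtain ⟨rfl, rfl⟩ : a = 0 ∧ b = 0 := by simpa using hab
    simp [linearCoeff]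
  | cons i L ih =>
    have hi := h i List.mem_cons_self
    have ih : ∀ a b, a + b = L.length → _ := fun a b hab =>
      ih (a := a) (b := b) (fun k hk => h k (List.mem_cons_of_mem _ hk)) hab
    rw [List.length_cons] at hab ⊢
    rcases a with _ | a <;> rcases b with _ | b
    · omega
    · rw [linearCoeff, ih 0 b (by omega), hi.2]
      simp
    · rw [linearCoeff, ih a 0 (by omega), hi.1, ← hab, show L.length = a by omega]
      simp
    · rw [linearCoeff, ih a (b + 1) (by omega), ih (a + 1) b (by omega), hi.1, hi.2,
        Nat.choose_succ_succ]
      push_cast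
      ring

end ListChain

/-! ### A Borsuk–Ulam theorem for products of two spheres -/

lemma exists_antipodal_function (d : ℕ) :
    ∃ α : Metric.sphere (0 : EuclideanSpace ℝ (Fin (d + 1))) 1 → ZMod 2,
      ∀ x, α (-x) = α x + 1 := by
  classical
  let c : Metric.sphere (0 : EuclideanSpace ℝ (Fin (d + 1))) 1 → Lex (Fin (d + 1) → ℝ) :=
    fun x => toLex (WithLp.ofLp (x : EuclideanSpace ℝ (Fin (d + 1))))
  have hneg : ∀ x, c (-x) = -c x := fun x => rfl
  have hne : ∀ x, c x ≠ 0 := by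
    intro x hx
    refine ne_zero_of_mem_unit_sphere x ?_
    ext i
    exact congrFun hx i
  refine ⟨fun x => if c x < 0 then 1 else 0, fun x => ?_⟩
  simp only [hneg]
  rcases lt_or_gt_of_ne (hne x) with h | h
  · have h' : ¬ -c x < 0 := (neg_pos.2 h).not_gt
    split_ifs with h3
    · exact (CharTwo.add_self_eq_zero (1 : ZMod 2)).symm
    · exact absurd h h3
  · have h' : -c x < 0 := neg_lt_zero.2 h
    have h'' : ¬ c x < 0 := h.not_gt
    split_ifs
    exact (zero_add 1).symm

/-- The sign by which a function changes, given the class in `ZMod 2` it represents. -/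
def boolSign (s : Bool) : ℝ := if s then -1 else 1

/-- The class in `ZMod 2` of a Boolean. -/
def boolClass (s : Bool) : ZMod 2 := if s then 1 else 0

/-- Continuous functions `F i` on `S^d × S^d`, odd or even in each variable as prescribed by
`p i` and `q i`, have a common zero if the coefficient of `e₁ ^ a * e₂ ^ b` in the product of the
linear forms `p i * e₁ + q i * e₂` is odd. -/
theorem exists_common_zero_of_linearCoeff_ne_zero {ι : Type*} {d : ℕ} {p q : ι → Bool}
    {F : ι → Metric.sphere (0 : EuclideanSpace ℝ (Fin (d + 1))) 1 →
      Metric.sphere (0 : EuclideanSpace ℝ (Fin (d + 1))) 1 → ℝ}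
    (hF : ∀ i, Continuous fun z : _ × _ => F i z.1 z.2)
    (hp : ∀ i u v, F i (-u) v = boolSign (p i) * F i u v)
    (hq : ∀ i u v, F i u (-v) = boolSign (q i) * F i u v)
    {L : List ι} {a b : ℕ} (ha : a ≤ d) (hb : b ≤ d) (hab : a + b = L.length)
    (hL : ListChain.linearCoeff (fun i => boolClass (p i)) (fun i => boolClass (q i)) L a b ≠ 0) :
    ∃ u v, ∀ i ∈ L, F i u v = 0 := by
  classical
  by_contra! hzero
  obtain ⟨α, hα⟩ := exists_antipodal_function d
  obtain ⟨ε, hε, hball⟩ := lebesgue_number_lemma_of_metric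
    (s := (Set.univ : Set (Metric.sphere (0 : EuclideanSpace ℝ (Fin (d + 1))) 1 ×
      Metric.sphere (0 : EuclideanSpace ℝ (Fin (d + 1))) 1)))
    (c := fun k : {i // i ∈ L} × Bool => {z | 0 < boolSign k.2 * F k.1 z.1 z.2})
    isCompact_univ (fun k => isOpen_lt continuous_const (continuous_const.mul (hF _))) (by
      rintro ⟨u, v⟩ -
      obtain ⟨i, hi, h0⟩ := hzero u v
      rcases lt_or_gt_of_ne h0 with h | h
      · exact Set.mem_iUnion.2 ⟨(⟨i, hi⟩, true), by simpa [boolSign] using h⟩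
      · exact Set.mem_iUnion.2 ⟨(⟨i, hi⟩, false), by simpa [boolSign] using h⟩)
  obtain ⟨D, hD, hsmall⟩ := ListChain.exists_small_hemispheres d hε
  let t : ι → Metric.sphere (0 : EuclideanSpace ℝ (Fin (d + 1))) 1 →
      Metric.sphere (0 : EuclideanSpace ℝ (Fin (d + 1))) 1 → ZMod 2 := fun i u v =>
    if F i u v < 0 then 1 else if 0 < F i u v then 0 else
      boolClass (p i) * α u + boolClass (q i) * α v
  have htp : ∀ i u v, t i (-u) v = t i u v + boolClass (p i) := by
    intro i u v
    simp only [t, hp]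
    cases p i
    · simp [boolSign, boolClass]
    · rcases lt_trichotomy (F i u v) 0 with h | h | h
      · simp [boolSign, boolClass, h, h.not_gt, CharTwo.add_self_eq_zero]
      · simp only [boolSign, boolClass, h, hα]
        simp
        ring
      · simp [boolSign, boolClass, h, h.not_gt]
  have htq : ∀ i u v, t i u (-v) = t i u v + boolClass (q i) := by
    intro i u v
    simp only [t, hq]
    cases q i
    · simp [boolSign, boolClass]
    · rcases lt_trichotomy (F i u v) 0 with h | h | h
      · simp [boolSign, boolClass, h, h.not_gt, CharTwo.add_self_eq_zero]
      · simp only [boolSign, boolClass, h, hα]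
        simp
        ring
      · simp [boolSign, boolClass, h, h.not_gt]
  rw [← ListChain.pairing_cup_hemispheres htp htq hD hD L a b ha hb hab] at hL
  refine hL (ListChain.pairing_eq_zero fun l hl m hm => ?_)
  rcases l with _ | ⟨x, l⟩
  · simp
  rcases m with _ | ⟨y, m⟩
  · simp
  obtain ⟨⟨⟨i, hi⟩, s⟩, hsub⟩ := hball (x, y) (Set.mem_univ _)
  refine ListChain.cup_eq_zero (r := boolClass s) hi fun x' hx' y' hy' => ?_
  have hmem : (x', y') ∈ Metric.ball (x, y) ε := by
    rw [Metric.mem_ball, Prod.dist_eq, max_lt_iff]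
    exact ⟨hsmall a ha _ hl x' hx' x List.mem_cons_self,
      hsmall b hb _ hm y' hy' y List.mem_cons_self⟩
  have hs : 0 < boolSign s * F i x' y' := hsub hmem
  cases s
  · have h : 0 < F i x' y' := by simpa [boolSign] using hs
    simp [t, boolClass, h, h.not_gt]
  · have h : F i x' y' < 0 := by simpa [boolSign] using hs
    simp [t, boolClass, h]

/-- The component of a vector of `ℝ⁴` on the character of `(ℤ/2)²` given by a pair of Booleans. -/
def characterComponent (s : Bool × Bool) (x : Bool × Bool → ℝ) : ℝ :=
  x (false, false) + boolSign s.2 * x (false, true) + boolSign s.1 * x (true, false) +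
    boolSign s.1 * boolSign s.2 * x (true, true)

/-- For `d ≥ 1`, `j ≥ 1`: if `y^j·w^j ∉ ⟨π_{d+1}, π_{d+2}⟩` in `𝔽₂[y,w]`,
then there is no continuous `D₈`-equivariant map `S^d × S^d → S(R₄^{⊕j})`. -/
theorem statement4 (d j : ℕ) (hd : 1 ≤ d) (hj : 1 ≤ j)
    (h : (X 0 : MvPolynomial (Fin 2) (ZMod 2)) ^ j * X 1 ^ j ∉
      Ideal.span {piF2 (d + 1), piF2 (d + 2)}) :
    ¬ ExistsD8EquivariantMap d j := by
  rintro ⟨f, hnorm, hsum, h1, h2, -⟩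
  obtain ⟨a, b, hab, ha, hb, hodd⟩ := exists_odd_choose_of_not_mem_span hj h
  let F : (Bool × Bool) × Fin j → Metric.sphere (0 : EuclideanSpace ℝ (Fin (d + 1))) 1 →
      Metric.sphere (0 : EuclideanSpace ℝ (Fin (d + 1))) 1 → ℝ := fun k u v =>
    characterComponent k.1 fun c => f (u, v) (k.2, c)
  let B : Bool × Bool → List ((Bool × Bool) × Fin j) := fun s =>
    (List.finRange j).map fun i => (s, i)
  have hB : ∀ s, (B s).length = j := fun s => by simp [B]
  have hBmem : ∀ s, ∀ k ∈ B s, k.1 = s := by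
    intro s k hk
    obtain ⟨i, -, rfl⟩ := List.mem_map.1 hk
    rfl
  obtain ⟨u, v, hzero⟩ := exists_common_zero_of_linearCoeff_ne_zero (F := F)
    (p := fun k => k.1.1) (q := fun k => k.1.2)
    (L := B (true, false) ++ (B (false, true) ++ B (true, true))) (a := j + a) (b := j + b)
    (fun k => by
      have hc : ∀ c, Continuous fun z : Metric.sphere (0 : EuclideanSpace ℝ (Fin (d + 1))) 1 ×
          Metric.sphere (0 : EuclideanSpace ℝ (Fin (d + 1))) 1 => f (z.1, z.2) (k.2, c) :=
        fun c => (continuous_apply _).comp f.continuous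
      simp only [F, characterComponent]
      have := hc
      fun_prop)
    (fun k u v => by
      simp only [F, characterComponent, h1, boolSign]
      cases k.1.1 <;> cases k.1.2 <;> simp <;> ring)
    (fun k u v => by
      simp only [F, characterComponent, h2, boolSign]
      cases k.1.1 <;> cases k.1.2 <;> simp <;> ring)
    ha hb (by simp only [List.length_append, hB]; omega) (by
      have e1 := ListChain.linearCoeff_append_left (p := fun k => boolClass k.1.1)
        (q := fun k => boolClass k.1.2) (L := B (true, false))
        (fun k hk => by simp [hBmem _ k hk, boolClass]) (B (false, true) ++ B (true, true)) a (j + b)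
      have e2 := ListChain.linearCoeff_append_right (p := fun k => boolClass k.1.1)
        (q := fun k => boolClass k.1.2) (L := B (false, true))
        (fun k hk => by simp [hBmem _ k hk, boolClass]) (B (true, true)) a b
      have e3 := ListChain.linearCoeff_eq_choose (p := fun k => boolClass k.1.1)
        (q := fun k => boolClass k.1.2) (L := B (true, true))
        (fun k hk => by simp [hBmem _ k hk, boolClass]) (a := a) (b := b) (by rw [hB, hab])
      rw [hB] at e1 e2 e3
      rw [e1, e2, e3]
      exact hodd)
  have hmem : ∀ s i, (s, i) ∈ B s := fun s i => List.mem_map.2 ⟨i, List.mem_finRange i, rfl⟩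
  have hf : ∀ k, f (u, v) k = 0 := by
    rintro ⟨i, c⟩
    have z0 := hsum (u, v) i
    have z1 := hzero ((true, false), i) (by simp [hmem])
    have z2 := hzero ((false, true), i) (by simp [hmem])
    have z3 := hzero ((true, true), i) (by simp [hmem])
    simp only [Fintype.sum_prod_type, Fintype.sum_bool] at z0
    simp only [F, characterComponent, boolSign, if_true, Bool.false_eq_true, if_false] at z1 z2 z3
    rcases c with ⟨_ | _, _ | _⟩ <;> linarith
  simpa [hf] using hnorm (u, v)

end
end

section
/- For every integer q ≥ 1, the identity Π_{2^q} = Y^{2^q} holds in the ring R. -/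
open MvPolynomial

noncomputable section

/-- The relations `2Y, 2M, 4W, M² − W·Y` in `ℤ[Y,M,W]` (with `Y = X 0`, `M = X 1`, `W = X 2`). -/
def relIdeal : Ideal (MvPolynomial (Fin 3) ℤ) :=
  Ideal.span {2 * X 0, 2 * X 1, 4 * X 2, X 1 ^ 2 - X 2 * X 0}

/-- The ring `R = ℤ[Y,M,W]/⟨2Y, 2M, 4W, M² − W·Y⟩`. -/
abbrev Rring : Type := MvPolynomial (Fin 3) ℤ ⧸ relIdeal

/-- The image of `Y` in `R`. -/
def Yv : Rring := Ideal.Quotient.mk relIdeal (X 0)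

/-- The image of `M` in `R`. -/
def Mv : Rring := Ideal.Quotient.mk relIdeal (X 1)

/-- The image of `W` in `R`. -/
def Wv : Rring := Ideal.Quotient.mk relIdeal (X 2)

/-- `Π_d = Σ_{0 ≤ 2i ≤ d−1} (C(d−1−i, i) mod 2)·W^i·Y^{d−2i} ∈ R`,
the binomial coefficients being taken mod 2 as elements 0 or 1 of ℤ. -/
def PiR (d : ℕ) : Rring :=
  ∑ i ∈ Finset.range (d + 1),
    if 2 * i + 1 ≤ d then
      ((((d - 1 - i).choose i % 2 : ℕ) : Rring)) * Wv ^ i * Yv ^ (d - 2 * i)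
    else 0

/-- The ideal `A_j ⊆ R`. -/
def AIdeal (j : ℕ) : Ideal Rring :=
  if j % 2 = 0 then Ideal.span {Yv ^ (j / 2) * Wv ^ (j / 2)}
  else
    Ideal.span {Yv ^ ((j + 1) / 2) * Wv ^ ((j - 1) / 2) * Mv,
      Yv ^ ((j + 1) / 2) * Wv ^ ((j + 1) / 2)}

/-- The ideal `B_d ⊆ R`. -/
def BIdeal (d : ℕ) : Ideal Rring :=
  if d % 2 = 0 then
    Ideal.span {PiR ((d + 2) / 2), PiR ((d + 4) / 2), Mv * PiR (d / 2)}
  else Ideal.span {PiR ((d + 1) / 2), PiR ((d + 3) / 2)}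

/-- For `0 < i` with `2 * i < 2 ^ q`, the binomial coefficient `C(2 ^ q - 1 - i, i)` is even. -/
theorem two_pow_sub_one_sub_choose_mod_two (q : ℕ) {i : ℕ} (hi : 0 < i) (h : 2 * i < 2 ^ q) :
    (2 ^ q - 1 - i).choose i % 2 = 0 := by
  induction q generalizing i with
  | zero => simp at h; omega
  | succ q ih =>
    have lucas : (2 ^ (q + 1) - 1 - i).choose i ≡
        ((2 ^ (q + 1) - 1 - i) % 2).choose (i % 2) *
          ((2 ^ (q + 1) - 1 - i) / 2).choose (i / 2) [MOD 2] :=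
      Choose.choose_modEq_choose_mod_mul_choose_div_nat
    rw [lucas]
    rw [pow_succ] at h ⊢
    rcases Nat.mod_two_eq_zero_or_one i with hmod | hmod
    · have hdiv : (2 ^ q * 2 - 1 - i) / 2 = 2 ^ q - 1 - i / 2 := by omega
      rw [hdiv, Nat.mul_mod, ih (i := i / 2) (by omega) (by omega), mul_zero, Nat.zero_mod]
    · have htop : (2 ^ q * 2 - 1 - i) % 2 = 0 := by omega
      simp [hmod, htop]

/-- For every `q ≥ 1`, `Π_{2^q} = Y^{2^q}` in `R`. -/
theorem statement7 (q : ℕ) (hq : 1 ≤ q) : PiR (2 ^ q) = Yv ^ (2 ^ q) := by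
  have hpos : 0 < 2 ^ q := by positivity
  rw [PiR, Finset.sum_eq_single 0]
  · rw [if_pos (by omega)]
    simp
  · intro i _ hi
    split_ifs with h
    · rw [two_pow_sub_one_sub_choose_mod_two q (by omega) (by omega)]
      simp
    · rfl
  · simp

end
end

section
/- For every integer q ≥ 1 and every integer i ≥ 0, the element Y^{2^{q−1}}·W^i of R belongs to the ideal of R generated by Π_{2^{q−1}+i} and Π_{2^{q−1}+i+1}. -/
open MvPolynomial

noncomputable section

/-- The Fibonacci polynomials: `F₀ = 0`, `F₁ = 1`, `Fₙ₊₂ = y Fₙ₊₁ + w Fₙ`. -/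
def fibPoly {S : Type*} [CommRing S] (y w : S) : ℕ → S
  | 0 => 0
  | 1 => 1
  | n + 2 => y * fibPoly y w (n + 1) + w * fibPoly y w n

section fibPoly

variable {S : Type*} [CommRing S] (y w : S)

theorem fibPoly_add_two (n : ℕ) :
    fibPoly y w (n + 2) = y * fibPoly y w (n + 1) + w * fibPoly y w n := by
  rw [fibPoly]

theorem fibPoly_two_mul (n : ℕ) :
    fibPoly y w (2 * n) = fibPoly y w n * (2 * fibPoly y w (n + 1) - y * fibPoly y w n) ∧
    fibPoly y w (2 * n + 1) = fibPoly y w (n + 1) ^ 2 + w * fibPoly y w n ^ 2 := by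
  induction n with
  | zero => simp [fibPoly]
  | succ n ih =>
    obtain ⟨h₀, h₁⟩ := ih
    have h₂ := fibPoly_add_two y w (2 * n)
    have h₃ := fibPoly_add_two y w (2 * n + 1)
    have h := fibPoly_add_two y w n
    rw [h₀, h₁] at h₂
    rw [show 2 * n + 1 + 1 = 2 * n + 2 by ring, h₂, h₁] at h₃
    refine ⟨?_, ?_⟩
    · rw [show 2 * (n + 1) = 2 * n + 2 by ring, h₂, h]
      ring
    · rw [show 2 * (n + 1) + 1 = 2 * n + 1 + 2 by ring, h₃, h]
      ring

theorem mul_fibPoly_two_pow (hy : 2 * y = 0) (k : ℕ) :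
    y * fibPoly y w (2 ^ k) = y ^ 2 ^ k := by
  induction k with
  | zero => simp [fibPoly]
  | succ k ih =>
    rw [pow_succ' 2 k, (fibPoly_two_mul y w _).1, mul_comm 2 (2 ^ k), pow_mul, ← ih]
    linear_combination (fibPoly y w (2 ^ k) * fibPoly y w (2 ^ k + 1)
      - y * fibPoly y w (2 ^ k) ^ 2) * hy

theorem fibPoly_succ_eq_sum_choose (n : ℕ) :
    fibPoly y w (n + 1) =
      ∑ p ∈ Finset.HasAntidiagonal.antidiagonal n, (p.1.choose p.2 : S) * w ^ p.2 * y ^ (p.1 - p.2) := by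
  induction n using Nat.twoStepInduction with
  | zero => simp [fibPoly]
  | one => simp [fibPoly, Finset.Nat.antidiagonal_succ]
  | more n h₀ h₁ =>
    rw [fibPoly_add_two, h₁, h₀, Finset.Nat.antidiagonal_succ_succ',
      Finset.Nat.antidiagonal_succ']
    have key (a b : ℕ) : ((a + 1).choose (b + 1) : S) * w ^ (b + 1) * y ^ (a - b) =
        y * ((a.choose (b + 1) : S) * w ^ (b + 1) * y ^ (a - (b + 1))) +
          w * ((a.choose b : S) * w ^ b * y ^ (a - b)) := by
      rw [Nat.choose_succ_succ]
      rcases le_or_gt (b + 1) a with h | h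
      · obtain ⟨c, rfl⟩ := Nat.exists_eq_add_of_le h
        rw [show b + 1 + c - b = c + 1 by omega, Nat.add_sub_cancel_left]
        push_cast
        ring
      · rw [Nat.choose_eq_zero_of_lt h]
        push_cast
        ring
    simp [key, Finset.sum_add_distrib, Finset.mul_sum, mul_add]
    ring

end fibPoly

theorem two_mul_Yv : 2 * Yv = 0 := by
  have h : (2 * X 0 : MvPolynomial (Fin 3) ℤ) ∈ relIdeal := Ideal.subset_span (by simp)
  exact Ideal.Quotient.eq_zero_iff_mem.mpr h

theorem natCast_mod_two_mul_Yv (n : ℕ) : ((n % 2 : ℕ) : Rring) * Yv = n * Yv := by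
  conv_rhs => rw [← Nat.mod_add_div n 2]
  push_cast
  linear_combination -((n / 2 : ℕ) : Rring) * two_mul_Yv

theorem PiR_eq_mul_fibPoly (d : ℕ) : PiR d = Yv * fibPoly Yv Wv d := by
  cases d with
  | zero => simp [PiR, fibPoly]
  | succ n =>
    rw [fibPoly_succ_eq_sum_choose, ← Finset.Nat.sum_antidiagonal_swap,
      Finset.Nat.sum_antidiagonal_eq_sum_range_succ_mk, PiR, Finset.sum_range_succ,
      if_neg (by omega), add_zero, Finset.mul_sum]
    refine Finset.sum_congr rfl fun i hi => ?_
    simp only [Prod.fst_swap, Prod.snd_swap]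
    split_ifs with h
    · rw [show n + 1 - 1 - i = n - i by omega, show n + 1 - 2 * i = n - i - i + 1 by omega]
      linear_combination Wv ^ i * Yv ^ (n - i - i) *
        natCast_mod_two_mul_Yv ((n - i).choose i)
    · rw [Nat.choose_eq_zero_of_lt (by omega)]
      simp

theorem PiR_add_two (d : ℕ) : PiR (d + 2) = Yv * PiR (d + 1) + Wv * PiR d := by
  simp only [PiR_eq_mul_fibPoly, fibPoly_add_two]
  ring

theorem PiR_two_pow (k : ℕ) : PiR (2 ^ k) = Yv ^ 2 ^ k := by
  rw [PiR_eq_mul_fibPoly, mul_fibPoly_two_pow _ _ two_mul_Yv]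

/-- For every `q ≥ 1` and every `i ≥ 0`, the element
`Y^{2^{q−1}}·W^i` of `R` lies in the ideal `⟨Π_{2^{q−1}+i}, Π_{2^{q−1}+i+1}⟩`. -/
theorem statement8 (q i : ℕ) (hq : 1 ≤ q) :
    Yv ^ (2 ^ (q - 1)) * Wv ^ i ∈
      Ideal.span {PiR (2 ^ (q - 1) + i), PiR (2 ^ (q - 1) + i + 1)} := by
  induction i with
  | zero =>
    rw [pow_zero, mul_one, add_zero, ← PiR_two_pow]
    exact Ideal.subset_span (by simp)
  | succ i ih =>
    obtain ⟨a, b, h⟩ := Ideal.mem_span_pair.mp ih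
    refine Ideal.mem_span_pair.mpr ⟨b * Wv - a * Yv, a, ?_⟩
    rw [← add_assoc, PiR_add_two, pow_succ, ← mul_assoc, ← h]
    ring

end
end

section
/- For every integer q ≥ 1, the ideal A_{2^q} = ⟨Y^{2^{q−1}}·W^{2^{q−1}}⟩ of R is contained in the ideal B_{2^{q+1}−1} = ⟨Π_{2^q}, Π_{2^q+1}⟩ of R. -/
open MvPolynomial

noncomputable section

/-- The Lucas sequence `F₀ = 0`, `F₁ = 1`, `F_{n+2} = y F_{n+1} + w F_n`. -/
def lucasSeq {S : Type*} [CommRing S] (y w : S) : ℕ → S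
  | 0 => 0
  | 1 => 1
  | n + 2 => y * lucasSeq y w (n + 1) + w * lucasSeq y w n

theorem lucasSeq_add {S : Type*} [CommRing S] (y w : S) (m n : ℕ) :
    lucasSeq y w (m + n + 1) =
      lucasSeq y w (m + 1) * lucasSeq y w (n + 1) + w * lucasSeq y w m * lucasSeq y w n := by
  induction n using Nat.twoStepInduction with
  | zero => simp [lucasSeq]
  | one => simp [lucasSeq]; ring
  | more n ih₁ ih₂ =>
    have h : lucasSeq y w (m + (n + 2) + 1) =
      y * lucasSeq y w (m + (n + 1) + 1) + w * lucasSeq y w (m + n + 1) := rfl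
    have h₁ : lucasSeq y w (n + 2 + 1) =
      y * lucasSeq y w (n + 1 + 1) + w * lucasSeq y w (n + 1) := rfl
    have h₂ : lucasSeq y w (n + 2) = y * lucasSeq y w (n + 1) + w * lucasSeq y w n := rfl
    rw [h, ih₁, ih₂, h₁, h₂]
    ring

/-- `y F_{d+1}` as a sum over the antidiagonal of `d`. -/
theorem mul_lucasSeq_succ_eq_sum_choose {S : Type*} [CommRing S] (y w : S) (d : ℕ) :
    y * lucasSeq y w (d + 1) = ∑ p ∈ Finset.HasAntidiagonal.antidiagonal d,
      (p.2.choose p.1 : S) * w ^ p.1 * y ^ (p.2 + 1 - p.1) := by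
  induction d using Nat.twoStepInduction with
  | zero => simp [lucasSeq]
  | one => simp [lucasSeq, Finset.Nat.antidiagonal_succ, sq]
  | more d ih₁ ih₂ =>
    have h : y * lucasSeq y w (d + 2 + 1) =
      y * (y * lucasSeq y w (d + 1 + 1)) + w * (y * lucasSeq y w (d + 1)) := by
      simp only [lucasSeq]; ring
    have key (i j : ℕ) : ((j + 1).choose (i + 1) : S) * w ^ (i + 1) * y ^ (j + 1 + 1 - (i + 1)) =
        y * ((j.choose (i + 1) : S) * w ^ (i + 1) * y ^ (j + 1 - (i + 1))) +
          w * ((j.choose i : S) * w ^ i * y ^ (j + 1 - i)) := by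
      rw [Nat.choose_succ_succ, Nat.add_sub_add_right]
      rcases lt_or_ge j (i + 1) with hj | hj
      · rw [Nat.choose_eq_zero_of_lt hj]
        push_cast
        ring
      · obtain ⟨k, rfl⟩ := Nat.exists_eq_add_of_le hj
        have e₁ : i + 1 + k + 1 - i = k + 2 := by omega
        have e₂ : i + 1 + k + 1 - (i + 1) = k + 1 := by omega
        rw [e₁, e₂]
        push_cast
        ring
    rw [h, ih₁, ih₂, Finset.Nat.antidiagonal_succ_succ', Finset.Nat.antidiagonal_succ]
    simp only [Finset.sum_cons, Finset.sum_map, Function.Embedding.prodMap,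
      Function.Embedding.coeFn_mk, Prod.map, Function.Embedding.refl_apply, Nat.succ_eq_add_one,
      key, Finset.sum_add_distrib, ← Finset.mul_sum]
    simp
    ring

/-- If `2y = 0` then `y F_n = yⁿ` for `n` a power of two. -/
theorem mul_lucasSeq_two_pow {S : Type*} [CommRing S] {y w : S} (hy : 2 * y = 0) (q : ℕ) :
    y * lucasSeq y w (2 ^ q) = y ^ 2 ^ q := by
  induction q with
  | zero => simp [lucasSeq]
  | succ q ih =>
    obtain ⟨n, hn⟩ := Nat.exists_eq_succ_of_ne_zero (pow_ne_zero q two_ne_zero : 2 ^ q ≠ 0)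
    have h₁ : 2 ^ (q + 1) = (n + 1) + n + 1 := by rw [pow_succ, hn]; omega
    have h₂ : y ^ 2 ^ (q + 1) = (y ^ 2 ^ q) ^ 2 := by rw [pow_succ, pow_mul]
    have h₃ : lucasSeq y w (n + 1 + 1) = y * lucasSeq y w (n + 1) + w * lucasSeq y w n := rfl
    rw [h₂, ← ih, h₁, lucasSeq_add, h₃, hn]
    linear_combination (w * lucasSeq y w n * lucasSeq y w (n + 1)) * hy

/-- If `2y = 0` and `n = 2^{q+1}`, then `y F_{n+1} ≡ y w^{n/2}` modulo `y^{n/2+1}`. -/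
theorem exists_mul_lucasSeq_two_pow_add_one {S : Type*} [CommRing S] {y w : S}
    (hy : 2 * y = 0) (q : ℕ) :
    ∃ g, y * lucasSeq y w (2 ^ (q + 1) + 1) = y * (w ^ 2 ^ q + y ^ 2 ^ q * g) := by
  induction q with
  | zero => exact ⟨y, by simp [lucasSeq]; ring⟩
  | succ q ih =>
    obtain ⟨g, hg⟩ := ih
    obtain ⟨k, hk⟩ := Nat.exists_eq_succ_of_ne_zero (pow_ne_zero q two_ne_zero : 2 ^ q ≠ 0)
    have hF := mul_lucasSeq_two_pow (w := w) hy (q + 1)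
    have h₁ : 2 ^ (q + 1 + 1) + 1 = 2 ^ (q + 1) + 2 ^ (q + 1) + 1 := by ring
    have h₂ : 2 ^ (q + 1) = 2 * k + 2 := by rw [pow_succ, hk]; omega
    rw [h₁, lucasSeq_add]
    rw [h₂] at hF hg ⊢
    rw [hk] at hg
    simp only [Nat.succ_eq_add_one] at hg
    refine ⟨g ^ 2 + w * y ^ (2 * k), ?_⟩
    linear_combination
      (lucasSeq y w (2 * k + 2 + 1) + (w ^ (k + 1) + y ^ (k + 1) * g)) * hg +
        w * (lucasSeq y w (2 * k + 2) + y ^ (2 * k + 1)) * hF +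
        w ^ (k + 1) * y ^ (k + 1) * g * hy

theorem PiR_succ (d : ℕ) : PiR (d + 1) = Yv * lucasSeq Yv Wv (d + 1) := by
  rw [mul_lucasSeq_succ_eq_sum_choose, Finset.Nat.sum_antidiagonal_eq_sum_range_succ_mk, PiR,
    Finset.sum_range_succ, if_neg (by omega), add_zero]
  refine Finset.sum_congr rfl fun i hi => ?_
  have hi' := Finset.mem_range.1 hi
  split_ifs with h
  · obtain ⟨k, hk⟩ : ∃ k, d + 1 - 2 * i = k + 1 := ⟨d - 2 * i, by omega⟩
    have e : d - i + 1 - i = k + 1 := by omega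
    have hc := congrArg (Nat.cast (R := Rring)) (Nat.mod_add_div ((d - i).choose i) 2)
    push_cast at hc
    rw [Nat.add_sub_cancel, hk, e, ← hc]
    push_cast
    linear_combination (-(((d - i).choose i / 2 : ℕ) : Rring) * Wv ^ i * Yv ^ k) * two_mul_Yv
  · rw [Nat.choose_eq_zero_of_lt (by omega)]
    simp

/-- For every `q ≥ 1`, the ideal `A_{2^q} = ⟨Y^{2^{q−1}}·W^{2^{q−1}}⟩`
is contained in the ideal `B_{2^{q+1}−1} = ⟨Π_{2^q}, Π_{2^q+1}⟩` of `R`. -/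
theorem statement9 (q : ℕ) (hq : 1 ≤ q) :
    AIdeal (2 ^ q) ≤ BIdeal (2 ^ (q + 1) - 1) := by
  obtain ⟨q, rfl⟩ := Nat.exists_eq_add_of_le' hq
  obtain ⟨k, hk⟩ := Nat.exists_eq_succ_of_ne_zero (pow_ne_zero q two_ne_zero : 2 ^ q ≠ 0)
  obtain ⟨g, hg⟩ := exists_mul_lucasSeq_two_pow_add_one (w := Wv) two_mul_Yv q
  have hF := mul_lucasSeq_two_pow (w := Wv) two_mul_Yv (q + 1)
  have h₁ : 2 ^ (q + 1) = 2 * k + 2 := by rw [pow_succ, hk]; omega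
  have h₂ : 2 ^ (q + 1 + 1) - 1 = 4 * k + 3 := by rw [pow_succ, h₁]; omega
  rw [h₁] at hF hg
  rw [hk] at hg
  rw [← PiR_succ] at hF hg
  have e₁ : (2 * k + 2) / 2 = k + 1 := by omega
  have e₂ : (4 * k + 3 + 1) / 2 = 2 * k + 2 := by omega
  have e₃ : (4 * k + 3 + 3) / 2 = 2 * k + 2 + 1 := by omega
  rw [h₁, h₂, AIdeal, BIdeal, if_pos (by omega), if_neg (by omega), e₁, e₂, e₃, hF, hg,
    Ideal.span_singleton_le_iff_mem, Ideal.mem_span_pair]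
  exact ⟨-g, Yv ^ k, by rw [Nat.succ_eq_add_one]; ring⟩

end
end

section
/- Let j ≥ 1 and d ≥ 0 be integers. In the polynomial ring 𝔽₂[a,c] over the field with two elements, if a^j·c^j·(a+c)^j belongs to the ideal generated by a^{d+1} and c^{d+1}, then a^j·c^j·(a+c)^j belongs to the ideal generated by a^{d+1}+c^{d+1} and a^{d+2}+c^{d+2}. -/
open MvPolynomial

namespace MvPolynomial

variable {σ R : Type*} [CommRing R]

theorem X_sub_X_dvd_sub_aeval_update [DecidableEq σ] (i k : σ) (p : MvPolynomial σ R) :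
    X i - X k ∣ p - aeval (Function.update X i (X k : MvPolynomial σ R)) p := by
  induction p using MvPolynomial.induction_on with
  | C r => simp
  | add p q hp hq =>
    rw [map_add, add_sub_add_comm]
    exact dvd_add hp hq
  | mul_X p l hp =>
    rw [map_mul, aeval_X]
    refine dvd_mul_sub_mul hp ?_
    obtain rfl | hl := eq_or_ne l i
    · simp
    · simp [hl]

theorem X_sub_X_dvd_of_dvd_mul_X_pow [IsDomain R] {i k : σ} {p : MvPolynomial σ R} {n : ℕ}
    (h : X i - X k ∣ p * X k ^ n) : X i - X k ∣ p := by
  classical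
  have hp := X_sub_X_dvd_sub_aeval_update i k p
  obtain ⟨q, hq⟩ := h
  have hφ := congrArg (aeval (Function.update X i (X k : MvPolynomial σ R))) hq
  have hk : Function.update X i (X k : MvPolynomial σ R) k = X k := by
    obtain rfl | hki := eq_or_ne k i
    · simp
    · simp [hki]
  simp only [map_mul, map_pow, map_sub, aeval_X, hk, Function.update_self, sub_self,
    zero_mul] at hφ
  rwa [(mul_eq_zero.mp hφ).resolve_right (pow_ne_zero n (X_ne_zero k)), sub_zero] at hp

/-- The intersection of `⟨a ^ n, c ^ n⟩` with `⟨a - c⟩` is contained in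
`⟨a ^ n - c ^ n, a ^ (n + 1) - c ^ (n + 1)⟩`, for variables `a` and `c`. -/
theorem mem_span_pow_sub_pow_of_X_sub_X_dvd [IsDomain R] {i k : σ} {f : MvPolynomial σ R} {n : ℕ}
    (hf : f ∈ Ideal.span {X i ^ n, X k ^ n}) (hdvd : X i - X k ∣ f) :
    f ∈ Ideal.span {X i ^ n - X k ^ n, X i ^ (n + 1) - X k ^ (n + 1)} := by
  obtain ⟨x, y, rfl⟩ := Ideal.mem_span_pair.mp hf
  have hxy : X i - X k ∣ (x + y) * X k ^ n := by
    have hx : X i - X k ∣ x * (X i ^ n - X k ^ n) :=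
      (sub_dvd_pow_sub_pow (X i) (X k) n).mul_left x
    convert dvd_sub hdvd hx using 1
    ring
  obtain ⟨z, hz⟩ := X_sub_X_dvd_of_dvd_mul_X_pow hxy
  refine Ideal.mem_span_pair.mpr ⟨x - z * X i, z, ?_⟩
  linear_combination -X k ^ n * hz

end MvPolynomial

/-- In `𝔽₂[a,c]` (with `a = X 0`, `c = X 1`), for `j ≥ 1` and `d ≥ 0`:
if `a^j·c^j·(a+c)^j ∈ ⟨a^{d+1}, c^{d+1}⟩` then
`a^j·c^j·(a+c)^j ∈ ⟨a^{d+1}+c^{d+1}, a^{d+2}+c^{d+2}⟩`. -/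
theorem statement12 (j d : ℕ) (hj : 1 ≤ j)
    (h : (X 0 : MvPolynomial (Fin 2) (ZMod 2)) ^ j * X 1 ^ j * (X 0 + X 1) ^ j ∈
      Ideal.span {(X 0 : MvPolynomial (Fin 2) (ZMod 2)) ^ (d + 1), X 1 ^ (d + 1)}) :
    (X 0 : MvPolynomial (Fin 2) (ZMod 2)) ^ j * X 1 ^ j * (X 0 + X 1) ^ j ∈
      Ideal.span {(X 0 : MvPolynomial (Fin 2) (ZMod 2)) ^ (d + 1) + X 1 ^ (d + 1),
        X 0 ^ (d + 2) + X 1 ^ (d + 2)} := by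
  have hdvd : (X 0 - X 1 : MvPolynomial (Fin 2) (ZMod 2)) ∣
      X 0 ^ j * X 1 ^ j * (X 0 + X 1) ^ j := by
    rw [CharTwo.sub_eq_add]
    exact (dvd_pow_self _ (Nat.one_le_iff_ne_zero.mp hj)).mul_left _
  simpa only [CharTwo.sub_eq_add] using mem_span_pow_sub_pow_of_X_sub_X_dvd h hdvd
end

section
/- Let j ≥ 1 and d ≥ 0 be integers. In the polynomial ring 𝔽₂[a,b] over the field with two elements, if a^j·b^j·(a+b)^j belongs to the ideal generated by a^{d+1} and (a+b)^{d+1}, then a^j·b^j·(a+b)^j belongs to the ideal generated by a^{d+1}+(a+b)^{d+1} and a^{d+2}+(a+b)^{d+2}. (Consequently the 𝔽₂-coefficient D₈ index bound for the two-hyperplane mass partition problem gives the same bounds as the bound obtained from the subgroup (ℤ/2)².) -/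
open MvPolynomial

/-- If `b` is a prime not dividing `a` in a commutative ring of characteristic two, then every
multiple of `b` in `⟨a^n, (a+b)^n⟩` lies in `⟨a^n + (a+b)^n, a^(n+1) + (a+b)^(n+1)⟩`. -/
theorem mem_span_pow_add_pow_of_mem_span_pow_pow {R : Type*} [CommRing R] [CharP R 2]
    {a b f : R} (n : ℕ) (hb : Prime b) (hba : ¬ b ∣ a) (hbf : b ∣ f)
    (hf : f ∈ Ideal.span {a ^ n, (a + b) ^ n}) :
    f ∈ Ideal.span {a ^ n + (a + b) ^ n, a ^ (n + 1) + (a + b) ^ (n + 1)} := by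
  have two_eq_zero : (2 : R) = 0 := CharTwo.two_eq_zero
  obtain ⟨u, v, rfl⟩ := Ideal.mem_span_pair.1 hf
  have hpow : b ∣ (a + b) ^ n - a ^ n := by
    simpa using sub_dvd_pow_sub_pow (a + b) a n
  have hmul : b ∣ (u + v) * a ^ n := by
    have := dvd_sub hbf (hpow.mul_left v)
    ring_nf at this ⊢
    exact this
  obtain ⟨c, hc⟩ := (hb.dvd_or_dvd hmul).resolve_right fun h => hba (hb.dvd_of_dvd_pow h)
  refine Ideal.mem_span_pair.2 ⟨v + c * (a + b), c, ?_⟩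
  linear_combination (-a ^ n) * hc +
    (v * a ^ n + c * a ^ (n + 1) + c * (a + b) ^ (n + 1)) * two_eq_zero

/-- In `𝔽₂[a,b]` (with `a = X 0`, `b = X 1`), for `j ≥ 1` and `d ≥ 0`:
if `a^j·b^j·(a+b)^j ∈ ⟨a^{d+1}, (a+b)^{d+1}⟩` then
`a^j·b^j·(a+b)^j ∈ ⟨a^{d+1}+(a+b)^{d+1}, a^{d+2}+(a+b)^{d+2}⟩`. -/
theorem statement13 (j d : ℕ) (hj : 1 ≤ j)
    (h : (X 0 : MvPolynomial (Fin 2) (ZMod 2)) ^ j * X 1 ^ j * (X 0 + X 1) ^ j ∈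
      Ideal.span {(X 0 : MvPolynomial (Fin 2) (ZMod 2)) ^ (d + 1), (X 0 + X 1) ^ (d + 1)}) :
    (X 0 : MvPolynomial (Fin 2) (ZMod 2)) ^ j * X 1 ^ j * (X 0 + X 1) ^ j ∈
      Ideal.span {(X 0 : MvPolynomial (Fin 2) (ZMod 2)) ^ (d + 1) + (X 0 + X 1) ^ (d + 1),
        X 0 ^ (d + 2) + (X 0 + X 1) ^ (d + 2)} := by
  refine mem_span_pow_add_pow_of_mem_span_pow_pow (d + 1) X_prime ?_ ?_ h
  · simp [X_dvd_X]
  · exact ((dvd_pow_self _ (by lia)).mul_left _).mul_right _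
end

section
/- Let φ : 𝔽₂[y,w] → 𝔽₂[a,b] be the 𝔽₂-algebra homomorphism determined by φ(y) = b and φ(w) = a·(a+b). Then φ(π_d) = a^d + (a+b)^d for every integer d ≥ 0. -/
open MvPolynomial

noncomputable section

/-- The bivariate Fibonacci polynomial `Σ_i C(n−i, i)·w^i·y^{n−2i}`. -/
def fibSum {R : Type*} [CommSemiring R] (y w : R) (n : ℕ) : R :=
  ∑ i ∈ Finset.range (n + 1), ((n - i).choose i : R) * w ^ i * y ^ (n - 2 * i)

theorem fibSum_add_two {R : Type*} [CommSemiring R] (y w : R) (n : ℕ) :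
    fibSum y w (n + 2) = y * fibSum y w (n + 1) + w * fibSum y w n := by
  unfold fibSum
  rw [Finset.sum_range_succ', Finset.sum_range_succ, Finset.sum_range_succ' _ (n + 1)]
  have hlast : (n + 2 - (n + 1 + 1)).choose (n + 1 + 1) = 0 :=
    Nat.choose_eq_zero_of_lt (by omega)
  have hterm : ∀ k ∈ Finset.range (n + 1),
      ((n + 2 - (k + 1)).choose (k + 1) : R) * w ^ (k + 1) * y ^ (n + 2 - 2 * (k + 1)) =
        y * (((n + 1 - (k + 1)).choose (k + 1) : R) * w ^ (k + 1) *
          y ^ (n + 1 - 2 * (k + 1))) +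
        w * (((n - k).choose k : R) * w ^ k * y ^ (n - 2 * k)) := by
    intro k hk
    rw [Finset.mem_range] at hk
    rw [show n + 2 - (k + 1) = (n - k) + 1 by omega, Nat.choose_succ_succ,
      show n + 1 - (k + 1) = n - k by omega, show n + 2 - 2 * (k + 1) = n - 2 * k by omega]
    by_cases h : 2 * k + 1 ≤ n
    · rw [show n - 2 * k = (n + 1 - 2 * (k + 1)) + 1 by omega]
      push_cast
      ring
    · rw [Nat.choose_eq_zero_of_lt (show n - k < k + 1 by omega)]
      push_cast
      ring
  rw [Finset.sum_congr rfl hterm, hlast, Finset.sum_add_distrib, ← Finset.mul_sum,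
    ← Finset.mul_sum]
  simp only [Nat.cast_zero, zero_mul, add_zero, mul_zero, Nat.sub_zero, Nat.choose_zero_right,
    Nat.cast_one, pow_zero, one_mul]
  ring

/-- In characteristic two, `(x + z)` times the Fibonacci polynomial at `x + z`, `x * z` is a
power sum. -/
theorem mul_fibSum_eq_pow_add_pow {R : Type*} [CommRing R] [CharP R 2] (x z : R) (n : ℕ) :
    (x + z) * fibSum (x + z) (x * z) n = x ^ (n + 1) + z ^ (n + 1) := by
  have h2 : (2 : R) = 0 := CharTwo.two_eq_zero
  induction n using Nat.twoStepInduction with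
  | zero => simp [fibSum]
  | one =>
    simp only [fibSum, Finset.sum_range_succ, Finset.sum_range_zero]
    norm_num
    linear_combination (x * z) * h2
  | more n ih ih' =>
    rw [fibSum_add_two]
    linear_combination (x + z) * ih' + (x * z) * ih + (x * z) * (x ^ (n + 1) + z ^ (n + 1)) * h2

theorem piF2_succ (n : ℕ) : piF2 (n + 1) = X 0 * fibSum (X 0) (X 1) n := by
  unfold piF2 fibSum
  rw [Finset.sum_range_succ, if_neg (by omega), add_zero, Finset.mul_sum]
  refine Finset.sum_congr rfl fun i _ => ?_
  split_ifs with h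
  · rw [show n + 1 - 2 * i = (n - 2 * i) + 1 by omega, Nat.add_sub_cancel, map_natCast]
    ring
  · rw [Nat.choose_eq_zero_of_lt (by omega)]
    simp

theorem map_fibSum {R S F : Type*} [CommSemiring R] [CommSemiring S] [FunLike F R S]
    [RingHomClass F R S] (f : F) (y w : R) (n : ℕ) :
    f (fibSum y w n) = fibSum (f y) (f w) n := by
  simp [fibSum]

/-- Let `φ : 𝔽₂[y,w] → 𝔽₂[a,b]` be the `𝔽₂`-algebra map with
`φ(y) = b` and `φ(w) = a·(a+b)` (here `a = X 0`, `b = X 1` in the target).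
Then `φ(π_d) = a^d + (a+b)^d` for every `d ≥ 0`. -/
theorem statement15 (d : ℕ) :
    aeval ![(X 1 : MvPolynomial (Fin 2) (ZMod 2)), X 0 * (X 0 + X 1)] (piF2 d)
      = (X 0 : MvPolynomial (Fin 2) (ZMod 2)) ^ d + (X 0 + X 1) ^ d := by
  cases d with
  | zero => simp [piF2, CharTwo.add_self_eq_zero]
  | succ n =>
    have hb : (X 0 + (X 0 + X 1) : MvPolynomial (Fin 2) (ZMod 2)) = X 1 := by
      rw [← add_assoc, CharTwo.add_self_eq_zero, zero_add]
    rw [← mul_fibSum_eq_pow_add_pow, hb, piF2_succ, map_mul, map_fibSum]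
    simp

end
end

section
/- Let d ≥ 0. The set of σ-invariant polynomials of 𝔽₂[a,b] that lie in the ideal I_d = ⟨a^{d+1}, (a+b)^{d+1}⟩ is, as an ideal of the invariant subring 𝔽₂[a,b]^σ = {p : σ(p) = p}, generated by the three invariant elements a^{d+1} + (a+b)^{d+1}, a^{d+2} + (a+b)^{d+2}, and a^{d+1}·(a+b)^{d+1}. -/
open MvPolynomial

noncomputable section

/-- The `𝔽₂`-algebra involution `σ` of `𝔽₂[a,b]` (with `a = X 0`, `b = X 1`)
determined by `σ(a) = a + b`, `σ(b) = b` (it interchanges `a` and `a+b`). -/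
def sigmaAut : MvPolynomial (Fin 2) (ZMod 2) →ₐ[ZMod 2] MvPolynomial (Fin 2) (ZMod 2) :=
  aeval ![X 0 + X 1, X 1]

@[simp]
lemma sigmaAut_X_zero : sigmaAut (X 0) = X 0 + X 1 := by
  simp [sigmaAut]

@[simp]
lemma sigmaAut_X_one : sigmaAut (X 1) = X 1 := by
  simp [sigmaAut]

@[simp]
lemma sigmaAut_sigmaAut (p : MvPolynomial (Fin 2) (ZMod 2)) : sigmaAut (sigmaAut p) = p := by
  suffices h : sigmaAut.comp sigmaAut = AlgHom.id (ZMod 2) _ from DFunLike.congr_fun h p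
  ext i : 1
  fin_cases i
  · simp [add_assoc, CharTwo.add_self_eq_zero]
  · simp

/-- `𝔽₂[a,b]` is spanned by `1` and `a` over the invariant subring. -/
lemma exists_invariant_add_invariant_mul_X (p : MvPolynomial (Fin 2) (ZMod 2)) :
    ∃ u v, sigmaAut u = u ∧ sigmaAut v = v ∧ p = u + v * X 0 := by
  induction p using MvPolynomial.induction_on with
  | C c => exact ⟨C c, 0, by simp [sigmaAut], by simp, by simp⟩
  | add p q hp hq =>
    obtain ⟨u, v, hu, hv, rfl⟩ := hp
    obtain ⟨u', v', hu', hv', rfl⟩ := hq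
    exact ⟨u + u', v + v', by simp [hu, hu'], by simp [hv, hv'], by ring⟩
  | mul_X p i hp =>
    have h2 : (2 : MvPolynomial (Fin 2) (ZMod 2)) = 0 := CharTwo.two_eq_zero
    obtain ⟨u, v, hu, hv, rfl⟩ := hp
    fin_cases i
    · refine ⟨v * (X 0 * (X 0 + X 1)), u + v * X 1, ?_, by simp [hu, hv], ?_⟩
      · simp only [map_mul, map_add, sigmaAut_X_zero, sigmaAut_X_one, hv]
        linear_combination v * (X 0 + X 1) * X 1 * h2
      · simp only [Fin.zero_eta]
        linear_combination -(v * X 0 * X 1) * h2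
    · exact ⟨u * X 1, v * X 1, by simp [hu], by simp [hv], by simp only [Fin.mk_one]; ring⟩

lemma not_X_zero_dvd_X_zero_add_X_one_pow (n : ℕ) :
    ¬ (X 0 : MvPolynomial (Fin 2) (ZMod 2)) ∣ (X 0 + X 1) ^ n := by
  intro h
  have h' : (X 0 : MvPolynomial (Fin 2) (ZMod 2)) ∣ X 1 :=
    (dvd_add_right dvd_rfl).1 (X_prime.dvd_of_dvd_pow h)
  simp [MvPolynomial.X_dvd_X] at h'

/-- For `d ≥ 0`: a polynomial `p` is `σ`-invariant and lies in
`I_d = ⟨a^{d+1}, (a+b)^{d+1}⟩` if and only if it lies in the ideal of the invariant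
subring `𝔽₂[a,b]^σ` generated by the three invariant elements
`a^{d+1} + (a+b)^{d+1}`, `a^{d+2} + (a+b)^{d+2}`, and `a^{d+1}·(a+b)^{d+1}`,
i.e. iff it is a combination of those three with `σ`-invariant coefficients. -/
theorem statement17 (d : ℕ) (p : MvPolynomial (Fin 2) (ZMod 2)) :
    (sigmaAut p = p ∧
        p ∈ Ideal.span
          {(X 0 : MvPolynomial (Fin 2) (ZMod 2)) ^ (d + 1), (X 0 + X 1) ^ (d + 1)}) ↔
      ∃ u v w : MvPolynomial (Fin 2) (ZMod 2),
        sigmaAut u = u ∧ sigmaAut v = v ∧ sigmaAut w = w ∧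
          p = u * ((X 0 : MvPolynomial (Fin 2) (ZMod 2)) ^ (d + 1) + (X 0 + X 1) ^ (d + 1)) +
              v * ((X 0 : MvPolynomial (Fin 2) (ZMod 2)) ^ (d + 2) + (X 0 + X 1) ^ (d + 2)) +
              w * ((X 0 : MvPolynomial (Fin 2) (ZMod 2)) ^ (d + 1) * (X 0 + X 1) ^ (d + 1)) := by
  have hy : sigmaAut (X 0 + X 1) = X 0 := by
    simp [add_assoc, CharTwo.add_self_eq_zero]
  constructor
  · rintro ⟨hp, hmem⟩
    obtain ⟨f, g, rfl⟩ := Ideal.mem_span_pair.1 hmem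
    have h2 : (2 : MvPolynomial (Fin 2) (ZMod 2)) = 0 := CharTwo.two_eq_zero
    rw [map_add, map_mul, map_mul, map_pow, map_pow, sigmaAut_X_zero, hy] at hp
    have hx0 : (X 0 : MvPolynomial (Fin 2) (ZMod 2)) ^ (d + 1) ≠ 0 :=
      pow_ne_zero _ (X_ne_zero 0)
    have key : (sigmaAut f + g) * (X 0 + X 1) ^ (d + 1) = (f + sigmaAut g) * X 0 ^ (d + 1) := by
      linear_combination hp + g * (X 0 + X 1) ^ (d + 1) * h2 -
        sigmaAut g * X 0 ^ (d + 1) * h2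
    obtain ⟨h, hh⟩ := X_prime.pow_dvd_of_dvd_mul_right (d + 1)
      (not_X_zero_dvd_X_zero_add_X_one_pow (d + 1)) ⟨_, key.trans (mul_comm _ _)⟩
    have hfg : f + sigmaAut g = h * (X 0 + X 1) ^ (d + 1) := by
      apply mul_right_cancel₀ hx0
      rw [← key, hh]
      ring
    have hinv : sigmaAut h = h := by
      apply mul_left_cancel₀ hx0
      have := congrArg sigmaAut hfg
      simp only [map_add sigmaAut f, map_mul, map_pow, hy, sigmaAut_sigmaAut] at this
      rw [← hh, this, mul_comm]
    obtain ⟨u, v, hu, hv, rfl⟩ := exists_invariant_add_invariant_mul_X f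
    refine ⟨u, v, h, hu, hv, hinv, ?_⟩
    simp only [map_add, map_mul, sigmaAut_X_zero, hu, hv] at hh
    linear_combination (X 0 + X 1) ^ (d + 1) * hh -
      (u + v * (X 0 + X 1)) * (X 0 + X 1) ^ (d + 1) * h2
  · rintro ⟨u, v, w, hu, hv, hw, rfl⟩
    constructor
    · have hx := sigmaAut_X_zero
      generalize (X 0 + X 1 : MvPolynomial (Fin 2) (ZMod 2)) = y at hx hy ⊢
      simp only [map_add, map_mul, map_pow, hx, hy, hu, hv, hw]
      ring
    · exact Ideal.mem_span_pair.2
        ⟨u + v * X 0 + w * (X 0 + X 1) ^ (d + 1), u + v * (X 0 + X 1), by ring⟩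

end
end
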